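/- There exists a constant C > 0 such that the following holds. For every directed graph G on a finite vertex set V of cardinality n with arc set E ⊆ V × V, every pair of distinct vertices s, t ∈ V, and every natural number k, there exists a family 𝒜 of subsets of V × V with |𝒜| ≤ 2^(C·(k+2)^4·log(k+2)) · (2 + log n)^(C·(k+2)^3) (log denoting the natural logarithm) such that for every minimal st-cut Z of G with |Z| ≤ k there exists A ∈ 𝒜 for which Z is an st-cut of the augmented graph G+A and, moreover, a minimum st-cut of G+A. -/

import Mathlib

open scoped Classical

namespace FlowAug

variable {V : Type}

/-- Reachability from `a` to `b` using arcs in `A`. -/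
def Reach (A : Set (V × V)) (a b : V) : Prop :=
  Relation.ReflTransGen (fun u v => (u, v) ∈ A) a b

/-- `Z` is an `st`-cut of the directed graph with arc set `E`. -/
def IsCut (E : Finset (V × V)) (s t : V) (Z : Finset (V × V)) : Prop :=
  Z ⊆ E ∧ ¬ Reach ((E : Set (V × V)) \ (Z : Set (V × V))) s t

/-- A minimal `st`-cut: no proper subset is an `st`-cut. -/
def IsMinimalCut (E : Finset (V × V)) (s t : V) (Z : Finset (V × V)) : Prop :=
  IsCut E s t Z ∧ ∀ Z', Z' ⊂ Z → ¬ IsCut E s t Z'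

/-- A minimum `st`-cut: of minimum cardinality among all `st`-cuts. -/
def IsMinCut (E : Finset (V × V)) (s t : V) (Z : Finset (V × V)) : Prop :=
  IsCut E s t Z ∧ ∀ Z', IsCut E s t Z' → Z.card ≤ Z'.card

/-- `Z ⊆ E` is an `st`-cut of the augmented graph `G + A`. -/
def IsCutAug (E A : Finset (V × V)) (s t : V) (Z : Finset (V × V)) : Prop :=
  Z ⊆ E ∧ ¬ Reach (((E : Set (V × V)) \ (Z : Set (V × V))) ∪ (A : Set (V × V))) s t

/-- A minimum `st`-cut of the augmented graph `G + A`. -/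
def IsMinCutAug (E A : Finset (V × V)) (s t : V) (Z : Finset (V × V)) : Prop :=
  IsCutAug E A s t Z ∧ ∀ Z', IsCutAug E A s t Z' → Z.card ≤ Z'.card

/-- The `s`-side of the cut `Z`: vertices reachable from `s` using arcs of `E \ Z`. -/
def sSide (E : Finset (V × V)) (s : V) (Z : Finset (V × V)) : Set V :=
  {v | Reach ((E : Set (V × V)) \ (Z : Set (V × V))) s v}

/-- A star `st`-cut: every arc of `Z` has tail in the `s`-side and head in the `t`-side. -/
def IsStarCut (E : Finset (V × V)) (s t : V) (Z : Finset (V × V)) : Prop :=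
  IsCut E s t Z ∧ ∀ e ∈ Z, e.1 ∈ sSide E s Z ∧ e.2 ∉ sSide E s Z

/-- `A` is compatible with the star `st`-cut `Z`: no arc of `A` goes from the
`s`-side of `Z` to the `t`-side of `Z`. -/
def Compatible (E : Finset (V × V)) (s : V) (Z A : Finset (V × V)) : Prop :=
  ∀ e ∈ A, e.1 ∈ sSide E s Z → e.2 ∈ sSide E s Z

/-- `core_{G+A}(Z)`: arcs of `Z` whose head reaches `t` via arcs of `(E \ Z) ∪ A`. -/
noncomputable def coreAug (E A Z : Finset (V × V)) (t : V) : Finset (V × V) :=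
  Z.filter (fun e =>
    Reach (((E : Set (V × V)) \ (Z : Set (V × V))) ∪ (A : Set (V × V))) e.2 t)

/-- `core(Z)`: arcs of `Z` whose head reaches `t` via arcs of `E \ Z`. -/
noncomputable def core (E Z : Finset (V × V)) (t : V) : Finset (V × V) :=
  Z.filter (fun e => Reach ((E : Set (V × V)) \ (Z : Set (V × V))) e.2 t)

/-- `δ⁺(X)`: arcs of `E` with tail in `X` and head outside `X`. -/
noncomputable def deltaPlus (E : Finset (V × V)) (X : Set V) : Finset (V × V) :=
  E.filter (fun e => e.1 ∈ X ∧ e.2 ∉ X)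

/-- The arcs traversed by a walk given by its list of vertices. -/
def arcsOf (p : List V) : List (V × V) := p.zip p.tail

/-- `p` is a directed path from `s` to `t` using arcs of `A`. -/
def IsPathIn (A : Set (V × V)) (s t : V) (p : List V) : Prop :=
  p.Chain' (fun u v => (u, v) ∈ A) ∧ p.head? = some s ∧ p.getLast? = some t

/-- The paths `P i` are pairwise arc-disjoint. -/
def ArcDisjoint {lam : ℕ} (P : Fin lam → List V) : Prop :=
  ∀ i j, i ≠ j → ∀ e : V × V, ¬ (e ∈ arcsOf (P i) ∧ e ∈ arcsOf (P j))

/-- An `st`-flow: a family of pairwise arc-disjoint directed `st`-paths in `G`. -/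
def IsFlow (E : Finset (V × V)) (s t : V) {lam : ℕ} (P : Fin lam → List V) : Prop :=
  (∀ i, IsPathIn (E : Set (V × V)) s t (P i)) ∧ ArcDisjoint P

/-- A maximum `st`-flow: the number of paths equals the minimum cardinality of an `st`-cut. -/
def IsMaxFlow (E : Finset (V × V)) (s t : V) {lam : ℕ} (P : Fin lam → List V) : Prop :=
  IsFlow E s t P ∧ ∃ Z, IsMinCut E s t Z ∧ Z.card = lam

/-- Arcs of the residual graph `G^P`. -/
def ResArc (E : Finset (V × V)) {lam : ℕ} (P : Fin lam → List V) (u v : V) : Prop :=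
  ((u, v) ∈ E ∧ ∀ i, (u, v) ∉ arcsOf (P i)) ∨ (∃ i, (v, u) ∈ arcsOf (P i))

/-- Reachability in the residual graph `G^P`. -/
def ResReach (E : Finset (V × V)) {lam : ℕ} (P : Fin lam → List V) : V → V → Prop :=
  Relation.ReflTransGen (ResArc E P)

/-- `G` has proper boundaries: `δ⁺({s})` and `δ⁻({t})` are minimum `st`-cuts
and there is no arc `(s, t)`. -/
def ProperBoundaries [DecidableEq V] (E : Finset (V × V)) (s t : V) : Prop :=
  IsMinCut E s t (E.filter (fun e => e.1 = s)) ∧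
  IsMinCut E s t (E.filter (fun e => e.2 = t)) ∧ (s, t) ∉ E

/-- The reachability pattern of `(G, P)` has only self-loops: no residual path
between internal vertices of distinct flow paths. -/
def OnlySelfLoops (E : Finset (V × V)) (s t : V) {lam : ℕ} (P : Fin lam → List V) : Prop :=
  ∀ i j : Fin lam, i ≠ j → ∀ u ∈ P i, u ≠ s → u ≠ t → ∀ v ∈ P j, v ≠ s → v ≠ t →
    ¬ ResReach E P u v

/-- A bottleneck arc: an arc contained in some minimum `st`-cut. -/
def Bottleneck (E : Finset (V × V)) (s t : V) (e : V × V) : Prop :=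
  ∃ Z, IsMinCut E s t Z ∧ e ∈ Z

/-- A witnessing flow for the star `st`-cut `Z` in `G + A`: `|core_{G+A}(Z)|`
`st`-paths in `G + A`, pairwise sharing no arc of `E \ A`, each containing
exactly one arc of `core_{G+A}(Z)` and no arc of `Z \ core_{G+A}(Z)`. -/
def WitnessingFlow (E A Z : Finset (V × V)) (s t : V) : Prop :=
  ∃ P : Fin (coreAug E A Z t).card → List V,
    (∀ i, IsPathIn ((E : Set (V × V)) ∪ (A : Set (V × V))) s t (P i)) ∧
    (∀ i j, i ≠ j → ∀ e : V × V, e ∈ arcsOf (P i) → e ∈ arcsOf (P j) →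
      e ∉ ((E : Set (V × V)) \ (A : Set (V × V)))) ∧
    (∀ i, ∃! e : V × V, e ∈ coreAug E A Z t ∧ e ∈ arcsOf (P i)) ∧
    (∀ i, ∀ e ∈ arcsOf (P i), e ∈ Z → e ∈ coreAug E A Z t)

/-- A set is closed under a relation if it contains all successors of its elements. -/
def Closed {α : Type} (A : α → α → Prop) (X : Set α) : Prop :=
  ∀ u v, A u v → u ∈ X → v ∈ X

/-- Tails and heads of the arcs sitting at given positions of a family of chains. -/
inductive Port (ι : Type)
  | tail (j : ι) (n : ℕ)
  | head (j : ι) (n : ℕ)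

section Chains

variable {ι : Type}

/-- The ports lying below the cut with coordinates `x`. -/
def below (x : ι → ℕ) : Set (Port ι) :=
  {v | match v with
    | Port.tail j n => n ≤ x j
    | Port.head j n => n < x j}

@[simp] lemma tail_mem_below {x : ι → ℕ} {j : ι} {n : ℕ} :
    Port.tail j n ∈ below x ↔ n ≤ x j := Iff.rfl

@[simp] lemma head_mem_below {x : ι → ℕ} {j : ι} {n : ℕ} :
    Port.head j n ∈ below x ↔ n < x j := Iff.rfl

/-- The ports on the chains in `K` of the cuts of `D` between `x` and `y`. -/
def ports (D : Finset (ι → ℕ)) (x y : ι → ℕ) (K : Finset ι) : Set (Port ι) :=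
  {v | ∃ j ∈ K, ∃ z ∈ D, x ≤ z ∧ z ≤ y ∧ (v = Port.tail j (z j) ∨ v = Port.head j (z j))}

/-- `S` looks like a member of `D` that is constant on each chain between `x` and `y`. -/
def Clean (D : Finset (ι → ℕ)) (S : Set (Port ι)) (x y : ι → ℕ) : Prop :=
  ∃ u ∈ D, x ≤ u ∧ u ≤ y ∧ ∀ j, x j < y j →
    (u j = y j ∧ Port.tail j (y j) ∈ S) ∨ (u j = x j ∧ Port.head j (x j) ∉ S)

/-- Every increasing sequence in `D` has at most `r` steps that are not clean for `S`. -/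
def FewUnclean (r : ℕ) (D : Finset (ι → ℕ)) (S : Set (Port ι)) : Prop :=
  ∀ X : ℕ → ι → ℕ, Monotone X → (∀ h, X h ∈ D) →
    ∀ B : Finset ℕ, (∀ h ∈ B, ¬ Clean D S (X h) (X (h + 1))) → B.card ≤ r

/-- `S` separates `x` from `y` on the chains in `K` without following a single cut of `D`, and it
contains (avoids) everything below (above) a cut all of whose tails (heads) it contains (avoids). -/
structure Admissible (D : Finset (ι → ℕ)) (S : Set (Port ι)) (x y : ι → ℕ) (K : Finset ι) :
    Prop where
  tail_mem : ∀ j ∈ K, Port.tail j (x j) ∈ S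
  head_notMem : ∀ j ∈ K, Port.head j (y j) ∉ S
  no_transversal : ∀ z ∈ D, x ≤ z → z ≤ y →
    ¬ ∀ j ∈ K, Port.tail j (z j) ∈ S ∧ Port.head j (z j) ∉ S
  down : ∀ z ∈ D, x ≤ z → z ≤ y → (∀ j ∈ K, Port.tail j (z j) ∈ S) →
    ∀ w ∈ D, x ≤ w → w ≤ y → ∀ j ∈ K,
      (w j ≤ z j → Port.tail j (w j) ∈ S) ∧ (w j < z j → Port.head j (w j) ∈ S)
  up : ∀ z ∈ D, x ≤ z → z ≤ y → (∀ j ∈ K, Port.head j (z j) ∉ S) →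
    ∀ w ∈ D, x ≤ w → w ≤ y → ∀ j ∈ K,
      (z j ≤ w j → Port.head j (w j) ∉ S) ∧ (z j < w j → Port.tail j (w j) ∉ S)

/-- Pairs `(i, j)` such that no cut of `D` between `x` and `y` is at the top of chain `i` and at
the bottom of chain `j`. -/
noncomputable def pattern [Fintype ι] (D : Finset (ι → ℕ)) (x y : ι → ℕ) : Finset (ι × ι) :=
  Finset.univ.filter fun e => ∀ z ∈ D, x ≤ z → z ≤ y → ¬ (z e.1 = y e.1 ∧ z e.2 = x e.2)

lemma mem_pattern [Fintype ι] {D : Finset (ι → ℕ)} {x y : ι → ℕ} {e : ι × ι} :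
    e ∈ pattern D x y ↔ ∀ z ∈ D, x ≤ z → z ≤ y → ¬ (z e.1 = y e.1 ∧ z e.2 = x e.2) := by
  simp [pattern]

lemma diag_mem_pattern [Fintype ι] {D : Finset (ι → ℕ)} {x y : ι → ℕ} {j : ι} (h : x j < y j) :
    (j, j) ∈ pattern D x y := by
  rw [mem_pattern]
  rintro z - - - ⟨h₁, h₂⟩
  simp only at h₁ h₂
  omega

/-- The lattice operations on `D`. -/
structure IsLat (D : Finset (ι → ℕ)) : Prop where
  sup : ∀ x ∈ D, ∀ y ∈ D, x ⊔ y ∈ D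
  inf : ∀ x ∈ D, ∀ y ∈ D, x ⊓ y ∈ D

lemma IsLat.exists_inf {D : Finset (ι → ℕ)} (hD : IsLat D) {P : (ι → ℕ) → Prop}
    (hP : ∀ x y, P x → P y → P (x ⊓ y)) {a : ι → ℕ} (ha : a ∈ D) (hPa : P a) :
    ∃ b ∈ D, P b ∧ ∀ z ∈ D, P z → b ≤ z := by
  obtain ⟨b, hb, hmin⟩ := (D.filter P).exists_minimal ⟨a, by simp [ha, hPa]⟩
  rw [Finset.mem_filter] at hb
  refine ⟨b, hb.1, hb.2, fun z hz hPz => ?_⟩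
  have := hmin (y := b ⊓ z) (by simp [hD.inf b hb.1 z hz, hP b z hb.2 hPz]) inf_le_left
  exact this.trans inf_le_right

lemma IsLat.exists_sup {D : Finset (ι → ℕ)} (hD : IsLat D) {P : (ι → ℕ) → Prop}
    (hP : ∀ x y, P x → P y → P (x ⊔ y)) {a : ι → ℕ} (ha : a ∈ D) (hPa : P a) :
    ∃ b ∈ D, P b ∧ ∀ z ∈ D, P z → z ≤ b := by
  obtain ⟨b, hb, hmax⟩ := (D.filter P).exists_maximal ⟨a, by simp [ha, hPa]⟩
  rw [Finset.mem_filter] at hb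
  refine ⟨b, hb.1, hb.2, fun z hz hPz => ?_⟩
  have := hmax (y := b ⊔ z) (by simp [hD.sup b hb.1 z hz, hP b z hb.2 hPz]) le_sup_left
  exact le_sup_right.trans this

lemma IsLat.sup'_mem {D : Finset (ι → ℕ)} (hD : IsLat D) {κ : Type} {s : Finset κ}
    (hs : s.Nonempty) {f : κ → ι → ℕ} (hf : ∀ i ∈ s, f i ∈ D) : s.sup' hs f ∈ D :=
  Finset.sup'_mem (D : Set (ι → ℕ)) hD.sup _ _ _ hf

lemma IsLat.inf'_mem {D : Finset (ι → ℕ)} (hD : IsLat D) {κ : Type} {s : Finset κ}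
    (hs : s.Nonempty) {f : κ → ι → ℕ} (hf : ∀ i ∈ s, f i ∈ D) : s.inf' hs f ∈ D :=
  Finset.inf'_mem (D : Set (ι → ℕ)) hD.inf _ _ _ hf

/-- If no pair in `σ × (K \ σ)` belongs to the pattern, some cut is at the top on `σ` and at the
bottom on `K \ σ`. -/
lemma exists_split [Fintype ι] {D : Finset (ι → ℕ)} (hD : IsLat D) {x y : ι → ℕ} (hx : x ∈ D)
    (hy : y ∈ D) (hxy : x ≤ y) {K σ : Finset ι}
    (h : ∀ i ∈ σ, ∀ j ∈ K \ σ, (i, j) ∉ pattern D x y) :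
    ∃ U ∈ D, x ≤ U ∧ U ≤ y ∧ (∀ j ∈ σ, U j = y j) ∧ ∀ j ∈ K \ σ, U j = x j := by
  rcases σ.eq_empty_or_nonempty with rfl | hσ
  · exact ⟨x, hx, le_rfl, hxy, by simp, by simp⟩
  rcases (K \ σ).eq_empty_or_nonempty with hK | hK
  · exact ⟨y, hy, hxy, le_rfl, by simp, by simp [hK]⟩
  have key : ∀ i j, ∃ z ∈ D, x ≤ z ∧ z ≤ y ∧
      (i ∈ σ → j ∈ K \ σ → z i = y i ∧ z j = x j) := by
    intro i j
    by_cases hij : i ∈ σ ∧ j ∈ K \ σ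
    · have := h i hij.1 j hij.2
      rw [mem_pattern] at this
      push Not at this
      obtain ⟨z, hz, h1, h2, h3⟩ := this
      exact ⟨z, hz, h1, h2, fun _ _ => h3⟩
    · exact ⟨x, hx, le_rfl, hxy, fun h1 h2 => absurd ⟨h1, h2⟩ hij⟩
  choose T hT hxT hTy hTij using key
  have hin : ∀ i, (K \ σ).inf' hK (T i) ∈ D := fun i => hD.inf'_mem hK fun j _ => hT i j
  have hlo : ∀ i, x ≤ (K \ σ).inf' hK (T i) := fun i =>
    Finset.le_inf' _ _ fun j _ => hxT i j
  have hhi : ∀ i, (K \ σ).inf' hK (T i) ≤ y := fun i => by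
    obtain ⟨j, hj⟩ := hK
    exact (Finset.inf'_le _ hj).trans (hTy i j)
  refine ⟨σ.sup' hσ fun i => (K \ σ).inf' hK (T i), hD.sup'_mem hσ fun i _ => hin i, ?_, ?_, ?_, ?_⟩
  · obtain ⟨i, hi⟩ := hσ
    exact (hlo i).trans (Finset.le_sup' (fun i => (K \ σ).inf' hK (T i)) hi)
  · exact Finset.sup'_le _ _ fun i _ => hhi i
  · intro j hj
    refine le_antisymm (Finset.sup'_le hσ (fun i => (K \ σ).inf' hK (T i)) (fun i _ => hhi i) j) ?_
    refine le_trans ?_ (Finset.le_sup' (fun i => (K \ σ).inf' hK (T i)) hj j)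
    rw [Finset.inf'_apply]
    exact Finset.le_inf' _ _ fun l hl => (hTij j l hj hl).1.ge
  · intro j hj
    refine le_antisymm ?_ ?_
    · rw [Finset.sup'_apply]
      refine Finset.sup'_le _ _ fun i hi => ?_
      exact (Finset.inf'_le (T i) hj j).trans (hTij i j hi hj).2.le
    · obtain ⟨i, hi⟩ := hσ
      exact ((hlo i).trans (Finset.le_sup' (fun i => (K \ σ).inf' hK (T i)) hi)) j

/-- No cut between `u` and `z` is at the top of chain `i` and at the bottom of chain `j`, for any
`(i, j)` in `H`. -/
def Full (D : Finset (ι → ℕ)) (H : Finset (ι × ι)) (u z : ι → ℕ) : Prop :=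
  ∀ e ∈ H, ∀ w ∈ D, u ≤ w → w ≤ z → ¬ (w e.1 = z e.1 ∧ w e.2 = u e.2)

lemma Full.lt {D : Finset (ι → ℕ)} {H : Finset (ι × ι)} {u z : ι → ℕ} (h : Full D H u z)
    (hz : z ∈ D) (huz : u ≤ z) {j : ι} (hj : (j, j) ∈ H) : u j < z j :=
  lt_of_le_of_ne (huz j) fun hne => h _ hj z hz huz le_rfl ⟨rfl, hne.symm⟩

/-- A sequence of cuts from `x` to `y` advancing greedily by full steps. -/
structure Ladder (D : Finset (ι → ℕ)) (H : Finset (ι × ι)) (x y : ι → ℕ) (X : ℕ → ι → ℕ)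
    (m : ℕ) : Prop where
  zero : X 0 = x
  mono : Monotone X
  mem : ∀ h, X h ∈ D
  eq_top : ∀ h, m ≤ h → X h = y
  pos : 0 < m
  full : ∀ h, h + 1 < m → Full D H (X h) (X (h + 1))
  least : ∀ h, ∀ z ∈ D, X h ≤ z → z ≤ y → Full D H (X h) z → X (h + 1) ≤ z

lemma Ladder.le_top {D : Finset (ι → ℕ)} {H : Finset (ι × ι)} {x y : ι → ℕ} {X : ℕ → ι → ℕ}
    {m : ℕ} (hX : Ladder D H x y X m) (h : ℕ) : X h ≤ y := by
  rw [← hX.eq_top (max h m) (le_max_right _ _)]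
  exact hX.mono (le_max_left _ _)

lemma Ladder.bot_le {D : Finset (ι → ℕ)} {H : Finset (ι × ι)} {x y : ι → ℕ} {X : ℕ → ι → ℕ}
    {m : ℕ} (hX : Ladder D H x y X m) (h : ℕ) : x ≤ X h := by
  rw [← hX.zero]
  exact hX.mono (Nat.zero_le _)

lemma Ladder.lt {D : Finset (ι → ℕ)} {H : Finset (ι × ι)} {x y : ι → ℕ} {X : ℕ → ι → ℕ}
    {m : ℕ} (hX : Ladder D H x y X m) {h h' : ℕ} (hh : h < h') (hm : h' < m) {j : ι}
    (hj : (j, j) ∈ H) : X h j < X h' j :=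
  lt_of_lt_of_le ((hX.full h (by omega)).lt (hX.mem _) (hX.mono (Nat.le_succ h)) hj)
    (hX.mono (Nat.succ_le_of_lt hh) j)

lemma exists_full_step {D : Finset (ι → ℕ)} (hD : IsLat D) (H : Finset (ι × ι)) {y : ι → ℕ}
    (hy : y ∈ D) {u : ι → ℕ} (huy : u ≤ y) :
    ∃ v ∈ D, u ≤ v ∧ v ≤ y ∧ (v = y ∨ Full D H u v) ∧
      ∀ z ∈ D, u ≤ z → z ≤ y → Full D H u z → v ≤ z := by
  by_cases hex : ∃ z ∈ D, u ≤ z ∧ z ≤ y ∧ Full D H u z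
  · obtain ⟨z, hz, hz'⟩ := hex
    obtain ⟨v, hv, hPv, hmin⟩ := hD.exists_inf (P := fun z => u ≤ z ∧ z ≤ y ∧ Full D H u z) (by
      rintro a b ⟨ha1, ha2, ha3⟩ ⟨hb1, hb2, hb3⟩
      refine ⟨le_inf ha1 hb1, inf_le_left.trans ha2, fun e he w hw huw hwab hcon => ?_⟩
      rcases le_total (a e.1) (b e.1) with hab | hab
      · exact ha3 e he w hw huw (hwab.trans inf_le_left)
          ⟨by rw [hcon.1, Pi.inf_apply, inf_eq_left.2 hab], hcon.2⟩
      · exact hb3 e he w hw huw (hwab.trans inf_le_right)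
          ⟨by rw [hcon.1, Pi.inf_apply, inf_eq_right.2 hab], hcon.2⟩) hz hz'
    exact ⟨v, hv, hPv.1, hPv.2.1, Or.inr hPv.2.2, fun z hz h1 h2 h3 => hmin z hz ⟨h1, h2, h3⟩⟩
  · push Not at hex
    exact ⟨y, hy, huy, le_rfl, Or.inl rfl, fun z hz h1 h2 h3 => absurd h3 (hex z hz h1 h2)⟩

lemma exists_ladder [Fintype ι] {D : Finset (ι → ℕ)} (hD : IsLat D) {H : Finset (ι × ι)}
    {x y : ι → ℕ} (hx : x ∈ D) (hy : y ∈ D) (hxy : x ≤ y) {j : ι} (hj : (j, j) ∈ H)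
    (hlt : x j < y j) : ∃ X m, Ladder D H x y X m := by
  have step : ∀ u : {u // u ∈ D ∧ u ≤ y}, ∃ v : {u // u ∈ D ∧ u ≤ y}, u.1 ≤ v.1 ∧
      (v.1 = y ∨ Full D H u.1 v.1) ∧
      ∀ z ∈ D, u.1 ≤ z → z ≤ y → Full D H u.1 z → v.1 ≤ z := by
    rintro ⟨u, hu, huy⟩
    obtain ⟨v, hv, h1, h2, h3, h4⟩ := exists_full_step hD H hy huy
    exact ⟨⟨v, hv, h2⟩, h1, h3, h4⟩
  choose next h1 h2 h3 using step
  let Y : ℕ → {u // u ∈ D ∧ u ≤ y} := fun h => next^[h] ⟨x, hx, hxy⟩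
  have hYs : ∀ h, Y (h + 1) = next (Y h) := fun h => Function.iterate_succ_apply' _ _ _
  have hmono : Monotone fun h => (Y h).1 :=
    monotone_nat_of_le_succ fun h => by simp only [hYs]; exact h1 _
  have hex : ∃ h, (Y h).1 = y := by
    by_contra! hcon
    have hstep : ∀ h, h ≤ (Y h).1 j := by
      intro h
      induction h with
      | zero => exact Nat.zero_le _
      | succ h ih =>
        have hf : Full D H (Y h).1 (Y (h + 1)).1 := by
          have := h2 (Y h)
          rw [← hYs] at this
          exact this.resolve_left (hcon _)
        have := hf.lt (Y (h + 1)).2.1 (hmono (Nat.le_succ h)) hj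
        omega
    have := (hstep (y j + 1)).trans ((Y (y j + 1)).2.2 j)
    omega
  refine ⟨fun h => (Y h).1, Nat.find hex, rfl, hmono, fun h => (Y h).2.1, ?_, ?_, ?_, ?_⟩
  · intro h hh
    refine le_antisymm (Y h).2.2 ?_
    conv_lhs => rw [← Nat.find_spec hex]
    exact hmono hh
  · rw [Nat.find_pos]
    intro h0
    have : x = y := h0
    rw [this] at hlt
    omega
  · intro h hh
    have := h2 (Y h)
    rw [← hYs] at this
    exact this.resolve_left (Nat.find_min hex hh)
  · intro h z hz hz1 hz2 hz3
    simp only [hYs]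
    exact h3 _ z hz hz1 hz2 hz3

/-- Some cut of `D` is at the top on `σ` and at the bottom on `K \ σ`. -/
def Split (D : Finset (ι → ℕ)) (x y : ι → ℕ) (K σ : Finset ι) : Prop :=
  ∃ U ∈ D, x ≤ U ∧ U ≤ y ∧ (∀ j ∈ σ, U j = y j) ∧ ∀ j ∈ K \ σ, U j = x j

/-- On the chains in `σ`, the set `S` contains everything below `a`. -/
def InBelow (D : Finset (ι → ℕ)) (S : Set (Port ι)) (x y : ι → ℕ) (σ : Finset ι) (a : ι → ℕ) :
    Prop :=
  ∀ j ∈ σ, ∀ w ∈ D, x ≤ w → w ≤ y →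
    (w j ≤ a j → Port.tail j (w j) ∈ S) ∧ (w j < a j → Port.head j (w j) ∈ S)

/-- On the chains in `τ`, the set `S` avoids everything above `a`. -/
def OutAbove (D : Finset (ι → ℕ)) (S : Set (Port ι)) (x y : ι → ℕ) (τ : Finset ι) (a : ι → ℕ) :
    Prop :=
  ∀ j ∈ τ, ∀ w ∈ D, x ≤ w → w ≤ y →
    (a j ≤ w j → Port.head j (w j) ∉ S) ∧ (a j < w j → Port.tail j (w j) ∉ S)

lemma InBelow.mono {D : Finset (ι → ℕ)} {S : Set (Port ι)} {x y : ι → ℕ} {σ : Finset ι}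
    {a b : ι → ℕ} (h : InBelow D S x y σ b) (hab : a ≤ b) : InBelow D S x y σ a :=
  fun j hj w hw h1 h2 => ⟨fun h3 => (h j hj w hw h1 h2).1 (h3.trans (hab j)),
    fun h3 => (h j hj w hw h1 h2).2 (h3.trans_le (hab j))⟩

lemma OutAbove.mono {D : Finset (ι → ℕ)} {S : Set (Port ι)} {x y : ι → ℕ} {σ : Finset ι}
    {a b : ι → ℕ} (h : OutAbove D S x y σ a) (hab : a ≤ b) : OutAbove D S x y σ b :=
  fun j hj w hw h1 h2 => ⟨fun h3 => (h j hj w hw h1 h2).1 ((hab j).trans h3),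
    fun h3 => (h j hj w hw h1 h2).2 ((hab j).trans_lt h3)⟩

/-- At height `h` of the ladder, `S` follows the cut `X h` on the chains in `σ`, and stays below
`X f` on the other chains. -/
structure Mark (D : Finset (ι → ℕ)) (S : Set (Port ι)) (x y : ι → ℕ) (K : Finset ι)
    (X : ℕ → ι → ℕ) (m h f : ℕ) (σ : Finset ι) : Prop where
  sub : σ ⊆ K
  split : Split D x y K σ
  inBelow : InBelow D S x y σ (X h)
  outAbove : OutAbove D S x y (K \ σ) (X f)
  index_le : f ≤ h
  le_index : ∀ h', h' < h → h' ≤ f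
  empty : m ≤ h → σ = ∅

lemma Admissible.inBelow {D : Finset (ι → ℕ)} {S : Set (Port ι)} {x y : ι → ℕ} {K σ : Finset ι}
    (hS : Admissible D S x y K) (hD : IsLat D) (hσ : σ ⊆ K) (hsp : Split D x y K σ)
    {a : ι → ℕ} (ha : a ∈ D) (hxa : x ≤ a) (hay : a ≤ y) (h : ∀ j ∈ σ, Port.tail j (a j) ∈ S) :
    InBelow D S x y σ a := by
  obtain ⟨U, hU, hxU, hUy, hU1, hU2⟩ := hsp
  have h1 : ∀ j ∈ σ, (a ⊓ U) j = a j := fun j hj => by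
    rw [Pi.inf_apply, hU1 j hj, inf_eq_left.2 (hay j)]
  intro j hj w hw hxw hwy
  have := hS.down (a ⊓ U) (hD.inf a ha U hU) (le_inf hxa hxU) (inf_le_left.trans hay) (by
    intro l hl
    by_cases hlσ : l ∈ σ
    · rw [h1 l hlσ]; exact h l hlσ
    · have : (a ⊓ U) l = x l := by
        rw [Pi.inf_apply, hU2 l (by simp [hl, hlσ]), inf_eq_right.2 (hxa l)]
      rw [this]; exact hS.tail_mem l hl) w hw hxw hwy j (hσ hj)
  rwa [h1 j hj] at this

lemma Admissible.outAbove {D : Finset (ι → ℕ)} {S : Set (Port ι)} {x y : ι → ℕ} {K σ : Finset ι}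
    (hS : Admissible D S x y K) (hD : IsLat D) (hsp : Split D x y K σ)
    {a : ι → ℕ} (ha : a ∈ D) (hxa : x ≤ a) (hay : a ≤ y)
    (h : ∀ j ∈ K \ σ, Port.head j (a j) ∉ S) : OutAbove D S x y (K \ σ) a := by
  obtain ⟨U, hU, hxU, hUy, hU1, hU2⟩ := hsp
  have h1 : ∀ j ∈ K \ σ, (a ⊔ U) j = a j := fun j hj => by
    rw [Pi.sup_apply, hU2 j hj, sup_eq_left.2 (hxa j)]
  intro j hj w hw hxw hwy
  have := hS.up (a ⊔ U) (hD.sup a ha U hU) (hxa.trans le_sup_left) (sup_le hay hUy) (by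
    intro l hl
    by_cases hlσ : l ∈ σ
    · have : (a ⊔ U) l = y l := by
        rw [Pi.sup_apply, hU1 l hlσ, sup_eq_right.2 (hay l)]
      rw [this]; exact hS.head_notMem l hl
    · have hl' : l ∈ K \ σ := by simp [hl, hlσ]
      rw [h1 l hl']; exact h l hl') w hw hxw hwy j (Finset.sdiff_subset hj)
  rwa [h1 j hj] at this

section Run

variable [Fintype ι] {D : Finset (ι → ℕ)} {S : Set (Port ι)} {x y : ι → ℕ} {K : Finset ι}
  {X : ℕ → ι → ℕ} {m : ℕ}

lemma exists_mark_zero (hS : Admissible D S x y K) (hD : IsLat D) (hy : y ∈ D)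
    (hxy : x ≤ y) (hX : Ladder D (pattern D x y) x y X m) : Mark D S x y K X m 0 0 K where
  sub := le_rfl
  split := ⟨y, hy, hxy, le_rfl, by simp, by simp⟩
  inBelow := by
    refine hS.inBelow hD le_rfl ⟨y, hy, hxy, le_rfl, by simp, by simp⟩ (hX.mem 0)
      (hX.bot_le 0) (hX.le_top 0) ?_
    rw [hX.zero]; exact hS.tail_mem
  outAbove := by intro j hj; simp at hj
  index_le := le_rfl
  le_index := by omega
  empty := by have := hX.pos; omega

lemma exists_mark_top (hS : Admissible D S x y K) (hD : IsLat D) (hx : x ∈ D)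
    (hxy : x ≤ y) (hX : Ladder D (pattern D x y) x y X m) : Mark D S x y K X m m m ∅ where
  sub := by simp
  split := ⟨x, hx, le_rfl, hxy, by simp, by simp⟩
  inBelow := by intro j hj; simp at hj
  outAbove := by
    refine hS.outAbove hD ⟨x, hx, le_rfl, hxy, by simp, by simp⟩ (hX.mem m)
      (hX.bot_le m) (hX.le_top m) ?_
    rw [hX.eq_top m le_rfl]
    intro j hj
    exact hS.head_notMem j (Finset.sdiff_subset hj)
  index_le := le_rfl
  le_index := by omega
  empty := fun _ => rfl

lemma exists_mark_of_clean (hS : Admissible D S x y K) (hD : IsLat D) (hx : x ∈ D) (hy : y ∈ D)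
    (hxy : x ≤ y) (hK : ∀ j ∈ K, x j < y j) (hX : Ladder D (pattern D x y) x y X m) {h : ℕ}
    (hm : h + 1 < m) (hcl : Clean D S (X h) (X (h + 1))) :
    ∃ σ, Mark D S x y K X m (h + 1) h σ := by
  obtain ⟨u, hu, h1, h2, h3⟩ := hcl
  have hfull := hX.full h hm
  have hlt : ∀ j ∈ K, X h j < X (h + 1) j := fun j hj =>
    hfull.lt (hX.mem _) (hX.mono (Nat.le_succ h)) (diag_mem_pattern (hK j hj))
  let σ := K.filter fun j => u j = X (h + 1) j
  have hσ : ∀ j ∈ σ, u j = X (h + 1) j := fun j hj => (Finset.mem_filter.1 hj).2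
  have hσK : σ ⊆ K := Finset.filter_subset _ _
  have hσt : ∀ j ∈ σ, Port.tail j (X (h + 1) j) ∈ S := fun j hj => by
    rcases h3 j (hlt j (hσK hj)) with h | h
    · exact h.2
    · have := hσ j hj; have := hlt j (hσK hj); omega
  have hτ : ∀ j ∈ K \ σ, u j = X h j ∧ Port.head j (X h j) ∉ S := fun j hj => by
    rw [Finset.mem_sdiff] at hj
    rcases h3 j (hlt j hj.1) with h | h
    · exact absurd (Finset.mem_filter.2 ⟨hj.1, h.1⟩) hj.2
    · exact h
  have hsp : Split D x y K σ := exists_split hD hx hy hxy fun i hi j hj hij =>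
    hfull (i, j) hij u hu h1 h2 ⟨hσ i hi, (hτ j hj).1⟩
  exact ⟨σ, {
    sub := hσK
    split := hsp
    inBelow := hS.inBelow hD hσK hsp (hX.mem _) (hX.bot_le _) (hX.le_top _) hσt
    outAbove := hS.outAbove hD hsp (hX.mem _) (hX.bot_le _) (hX.le_top _) fun j hj => (hτ j hj).2
    index_le := Nat.le_succ h
    le_index := by omega
    empty := by omega }⟩

/-- The heights between `s` and `t` where `S` fails to follow the ladder, with `S` staying above
`X t` on `σ'` and below `X s` outside `σ`. -/
structure Run (D : Finset (ι → ℕ)) (S : Set (Port ι)) (x y : ι → ℕ) (K : Finset ι)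
    (X : ℕ → ι → ℕ) (m r s t : ℕ) (σ σ' : Finset ι) : Prop where
  sub : σ ⊆ K
  sub' : σ' ⊆ σ
  lt_top : s < m
  le : s ≤ t
  short : t ≤ s + (r + 1)
  split : Split D x y K σ
  split' : Split D x y K σ'
  inBelow : InBelow D S x y σ (X s)
  inBelow' : InBelow D S x y σ' (X t)
  outAbove : OutAbove D S x y (K \ σ) (X s)
  outAbove' : OutAbove D S x y (K \ σ') (X t)
  no_transversal : ∀ z ∈ D, X s ≤ z → z ≤ X t →
    ¬ ∀ j ∈ σ \ σ', Port.tail j (z j) ∈ S ∧ Port.head j (z j) ∉ S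
  leave : σ \ σ' = K → ∃ j ∈ K, Port.tail j (X (s + 1) j) ∉ S

lemma exists_run (hS : Admissible D S x y K) {r : ℕ} (hr : FewUnclean r D S) (hD : IsLat D)
    (hx : x ∈ D) (hy : y ∈ D) (hxy : x ≤ y) (hK : ∀ j ∈ K, x j < y j)
    (hX : Ladder D (pattern D x y) x y X m) : ∃ s t σ σ', Run D S x y K X m r s t σ σ' := by
  let Q : ℕ → Prop := fun h => ∃ f σ, Mark D S x y K X m h f σ ∧ ∃ z ∈ D, x ≤ z ∧ z ≤ y ∧
    (∀ j ∈ K \ σ, Port.tail j (z j) ∈ S ∧ Port.head j (z j) ∉ S) ∧ ∀ j ∈ σ, z j ≤ X h j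
  have hQ0 : Q 0 := ⟨0, K, exists_mark_zero hS hD hy hxy hX, x, hx, le_rfl, hxy, by simp,
    fun j _ => by rw [hX.zero]⟩
  have hQm : ∀ h, m ≤ h → ¬ Q h := by
    rintro h hm ⟨f, σ, hM, z, hz, h1, h2, h3, -⟩
    obtain rfl := hM.empty hm
    exact hS.no_transversal z hz h1 h2 (by simpa using h3)
  set h := Nat.findGreatest Q m with hh
  have hQh : Q h := Nat.findGreatest_spec (P := Q) (Nat.zero_le m) hQ0
  have hmax : ∀ h', h < h' → ¬ Q h' := fun h' hlt hQ => by
    rcases le_total m h' with hm | hm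
    · exact hQm h' hm hQ
    · exact absurd (Nat.le_findGreatest hm hQ) (by omega)
  have hhm : h < m := by
    by_contra hcon
    exact hQm h (by omega) hQh
  have hex : ∃ h', h < h' ∧ ∃ f σ, Mark D S x y K X m h' f σ :=
    ⟨m, hhm, m, ∅, exists_mark_top hS hD hx hxy hX⟩
  set h' := Nat.find hex with hh'
  obtain ⟨hlt, t, σ', hM'⟩ := Nat.find_spec hex
  rw [← hh'] at hlt hM'
  have hh'm : h' ≤ m := Nat.find_min' hex ⟨hhm, m, ∅, exists_mark_top hS hD hx hxy hX⟩
  obtain ⟨f, σ, hM, zτ, hzτ, hz1, hz2, hz3, hz4⟩ := hQh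
  have hcount : h' ≤ h + 1 + r := by
    have := hr X hX.mono hX.mem (Finset.Ico h (h' - 1)) (by
      intro i hi hcl
      rw [Finset.mem_Ico] at hi
      obtain ⟨σ'', h''⟩ := exists_mark_of_clean hS hD hx hy hxy hK hX (by omega) hcl
      exact Nat.find_min hex (m := i + 1) (by omega) ⟨by omega, i, σ'', h''⟩)
    rw [Nat.card_Ico] at this
    omega
  have hσ : σ' ⊆ σ := by
    intro j hj
    by_contra hjσ
    have hjK := hM'.sub hj
    have hh'm' : h' < m := by
      by_contra hcon
      have := hM'.empty (by omega)
      simp [this] at hj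
    have h1 := (hM'.inBelow j hj (X h') (hX.mem _) (hX.bot_le _) (hX.le_top _)).1 le_rfl
    have hjτ : j ∈ K \ σ := by simp [hjK, hjσ]
    exact (hM.outAbove j hjτ (X h') (hX.mem _) (hX.bot_le _) (hX.le_top _)).2
      (hX.lt (hM.index_le.trans_lt hlt) hh'm' (diag_mem_pattern (hK j hjK))) h1
  have hth' : X t ≤ X h' := hX.mono hM'.index_le
  have hht : h ≤ t := hM'.le_index h hlt
  have hnt : ∀ z ∈ D, X h ≤ z → z ≤ X t →
      ¬ ∀ j ∈ σ \ σ', Port.tail j (z j) ∈ S ∧ Port.head j (z j) ∉ S := by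
    intro z hz hzh hzt htr
    obtain ⟨U, hU, hxU, hUy, hU1, hU2⟩ := hM.split
    have hzy : z ≤ y := hzt.trans (hX.le_top t)
    refine hmax h' hlt ⟨t, σ', hM', (z ⊓ U) ⊔ zτ, hD.sup _ (hD.inf _ hz _ hU) _ hzτ,
      hz1.trans le_sup_right, sup_le (inf_le_left.trans hzy) hz2, ?_, ?_⟩
    · intro j hj
      rw [Finset.mem_sdiff] at hj
      by_cases hjσ : j ∈ σ
      · have : ((z ⊓ U) ⊔ zτ) j = z j := by
          rw [Pi.sup_apply, Pi.inf_apply, hU1 j hjσ, inf_eq_left.2 (hzy j),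
            sup_eq_left.2 ((hz4 j hjσ).trans (hzh j))]
        rw [this]
        exact htr j (by simp [hjσ, hj.2])
      · have hjτ : j ∈ K \ σ := by simp [hjσ, hj.1]
        have : ((z ⊓ U) ⊔ zτ) j = zτ j := by
          rw [Pi.sup_apply, Pi.inf_apply, hU2 j hjτ]
          have := hz1 j
          exact sup_eq_right.2 (inf_le_right.trans this)
        rw [this]
        exact hz3 j hjτ
    · intro j hj
      rw [Pi.sup_apply, Pi.inf_apply]
      exact sup_le (inf_le_left.trans ((hzt.trans hth') j))
        ((hz4 j (hσ hj)).trans (hX.mono hlt.le j))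
  by_cases hJ : σ \ σ' = K
  · have hσK : σ = K := le_antisymm hM.sub (hJ ▸ Finset.sdiff_subset)
    subst hσK
    have hσ' : σ' = ∅ := by
      rw [Finset.sdiff_eq_self_iff_disjoint] at hJ
      exact Finset.eq_empty_of_forall_notMem fun j hj =>
        Finset.disjoint_left.1 hJ (hσ hj) hj
    subst hσ'
    let P : ℕ → Prop := fun i => ∀ j ∈ σ, Port.tail j (X i j) ∈ S
    have hPh : P h := fun j hj =>
      (hM.inBelow j hj (X h) (hX.mem _) (hX.bot_le _) (hX.le_top _)).1 le_rfl
    set s := Nat.findGreatest P m with hs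
    have hPs : P s := Nat.findGreatest_spec (P := P) hhm.le hPh
    have hhs : h ≤ s := Nat.le_findGreatest hhm.le hPh
    have hin := hS.inBelow hD le_rfl hM.split (hX.mem s) (hX.bot_le s) (hX.le_top s) hPs
    have hsm : s < m := by
      refine lt_of_le_of_ne (Nat.findGreatest_le m) fun hsm => ?_
      have hy' := hX.eq_top s (by omega)
      refine hS.no_transversal y hy hxy le_rfl fun j hj => ⟨?_, hS.head_notMem j hj⟩
      have := hPs j hj
      rwa [hy'] at this
    have hst : s < t := by
      by_contra! hts
      refine hnt (X t) (hX.mem t) (hX.mono hht) le_rfl fun j hj => ⟨?_, ?_⟩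
      · exact (hin j (Finset.sdiff_subset hj) (X t) (hX.mem _) (hX.bot_le _) (hX.le_top _)).1
          (hX.mono hts j)
      · exact (hM'.outAbove j hj (X t) (hX.mem _) (hX.bot_le _) (hX.le_top _)).1 le_rfl
    refine ⟨s, t, σ, ∅, {
      sub := le_rfl
      sub' := by simp
      lt_top := hsm
      le := hst.le
      short := by have := hM'.index_le; omega
      split := hM.split
      split' := hM'.split
      inBelow := hin
      inBelow' := hM'.inBelow.mono hth'
      outAbove := hM.outAbove.mono (hX.mono (hM.index_le.trans hhs))
      outAbove' := hM'.outAbove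
      no_transversal := fun z hz h1 h2 => hnt z hz ((hX.mono hhs).trans h1) h2
      leave := fun _ => ?_ }⟩
    by_contra! hcon
    have : s + 1 ≤ s := Nat.le_findGreatest hsm hcon
    omega
  · exact ⟨h, t, σ, σ', {
      sub := hM.sub
      sub' := hσ
      lt_top := hhm
      le := hht
      short := by have := hM'.index_le; omega
      split := hM.split
      split' := hM'.split
      inBelow := hM.inBelow
      inBelow' := hM'.inBelow.mono hth'
      outAbove := hM.outAbove.mono (hX.mono hM.index_le)
      outAbove' := hM'.outAbove
      no_transversal := hnt
      leave := fun h => absurd h hJ }⟩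

end Run

end Chains

section Chains
variable {ι : Type}

lemma ports_mono {D : Finset (ι → ℕ)} {x y x' y' : ι → ℕ} {K K' : Finset ι} (hx : x' ≤ x)
    (hy : y ≤ y') (hK : K ⊆ K') : ports D x y K ⊆ ports D x' y' K' := by
  rintro v ⟨j, hj, z, hz, h1, h2, h3⟩
  exact ⟨j, hK hj, z, hz, hx.trans h1, h2.trans hy, h3⟩

lemma mem_below_congr {D : Finset (ι → ℕ)} {x y z z' : ι → ℕ} {J : Finset ι} {v : Port ι}
    (hv : v ∈ ports D x y J) (h : ∀ j ∈ J, z j = z' j) : v ∈ below z ↔ v ∈ below z' := by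
  obtain ⟨j, hj, w, -, -, -, rfl | rfl⟩ := hv <;> simp [h j hj]

/-- The tail on chain `j` at height `h` of a ladder, or the last head if the ladder has ended. -/
def rung (X : ℕ → ι → ℕ) (m : ℕ) (y : ι → ℕ) (h : ℕ) (j : ι) : Port ι :=
  if h < m then Port.tail j (X h j) else Port.head j (y j)

/-- The heights at which a run is expected: `o, o + B, o + 2 * B, …`; a run is expected to have
length `L`, to stay above its end on `J₁`, below its start on `J₀`, and to leave the chain `p`
within one step. -/
structure Plan (ι : Type) where
  X : ℕ → ι → ℕ
  m : ℕ
  x : ι → ℕ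
  y : ι → ℕ
  J : Finset ι
  J₁ : Finset ι
  J₀ : Finset ι
  p : Option ι
  o : ℕ
  L : ℕ
  B : ℕ

namespace Plan

variable (Q : Plan ι)

/-- The start of the `i`-th window. -/
def start (i : ℕ) : ℕ := Q.o + i * Q.B

/-- The end of the `i`-th window. -/
def finish (i : ℕ) : ℕ := Q.start i + Q.L

/-- The cuts passing through the `i`-th window in the expected way. -/
def Passes (D : Finset (ι → ℕ)) (i : ℕ) (z : ι → ℕ) : Prop :=
  z ∈ D ∧ Q.X (Q.start i) ≤ z ∧ z ≤ Q.X (Q.finish i) ∧ (∀ l ∈ Q.J₁, z l = Q.X (Q.finish i) l) ∧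
    (∀ l ∈ Q.J₀, z l = Q.X (Q.start i) l) ∧ ∀ j ∈ Q.p, z j < Q.X (Q.start i + 1) j

/-- Arcs forcing every cut to pass through one of the windows in the expected way, together with
arcs `extra i` dealing with the `i`-th window. -/
inductive Glue (extra : ℕ → Port ι → Port ι → Prop) : Port ι → Port ι → Prop
  | enter (j j' : ι) (hj : j ∈ Q.J) (hj' : j' ∈ Q.J) :
      Glue extra (Port.tail j (Q.x j)) (rung Q.X Q.m Q.y Q.o j')
  | step (i : ℕ) (j j' : ι) (hi : Q.start i < Q.m) (hj : j ∈ Q.J) (hj' : j' ∈ Q.J) :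
      Glue extra (Port.head j (Q.X (Q.finish i) j)) (rung Q.X Q.m Q.y (Q.start (i + 1)) j')
  | up (i : ℕ) (j l : ι) (hi : Q.start i < Q.m) (hj : j ∈ Q.J) (hl : l ∈ Q.J₁) :
      Glue extra (Port.tail j (Q.X (Q.start i) j)) (Port.tail l (Q.X (Q.finish i) l))
  | down (i : ℕ) (j l : ι) (hi : Q.start i < Q.m) (hj : j ∈ Q.J) (hl : l ∈ Q.J₀) :
      Glue extra (Port.head l (Q.X (Q.start i) l)) (Port.head j (Q.X (Q.finish i) j))
  | leave (i : ℕ) (j l : ι) (hi : Q.start i < Q.m) (hj : j ∈ Q.J) (hl : l ∈ Q.p) :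
      Glue extra (Port.tail l (Q.X (Q.start i + 1) l)) (Port.head j (Q.X (Q.finish i) j))
  | extra (i : ℕ) (u v : Port ι) (hi : Q.start i < Q.m) (huv : extra i u v) : Glue extra u v

/-- The plan fits the interval from `x` to `y` on the chains in `K`. -/
structure Fits (D : Finset (ι → ℕ)) (H : Finset (ι × ι)) (K : Finset ι) : Prop where
  ladder : Ladder D H Q.x Q.y Q.X Q.m
  bot_mem : Q.x ∈ D
  top_mem : Q.y ∈ D
  le : Q.x ≤ Q.y
  nonempty : Q.J.Nonempty
  sub : Q.J ⊆ K
  sub₁ : Q.J₁ ⊆ K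
  sub₀ : Q.J₀ ⊆ K
  leave_mem : ∀ j ∈ Q.p, j ∈ Q.J
  pos : 0 < Q.B

variable {Q} {D : Finset (ι → ℕ)} {H : Finset (ι × ι)} {K : Finset ι}
  {extra : ℕ → Port ι → Port ι → Prop}

lemma Fits.start_le_finish (hQ : Q.Fits D H K) (i : ℕ) : Q.X (Q.start i) ≤ Q.X (Q.finish i) :=
  hQ.ladder.mono (Nat.le_add_right _ _)

lemma Fits.tail_mem_ports (hQ : Q.Fits D H K) (h : ℕ) {j : ι} (hj : j ∈ K) :
    Port.tail j (Q.X h j) ∈ ports D Q.x Q.y K :=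
  ⟨j, hj, Q.X h, hQ.ladder.mem h, hQ.ladder.bot_le h, hQ.ladder.le_top h, Or.inl rfl⟩

lemma Fits.head_mem_ports (hQ : Q.Fits D H K) (h : ℕ) {j : ι} (hj : j ∈ K) :
    Port.head j (Q.X h j) ∈ ports D Q.x Q.y K :=
  ⟨j, hj, Q.X h, hQ.ladder.mem h, hQ.ladder.bot_le h, hQ.ladder.le_top h, Or.inr rfl⟩

lemma Fits.rung_mem_ports (hQ : Q.Fits D H K) (h : ℕ) {j : ι} (hj : j ∈ K) :
    rung Q.X Q.m Q.y h j ∈ ports D Q.x Q.y K := by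
  unfold rung
  split_ifs
  · exact hQ.tail_mem_ports h hj
  · exact ⟨j, hj, Q.y, hQ.top_mem, hQ.le, le_rfl, Or.inr rfl⟩

lemma Fits.glue_mem_ports (hQ : Q.Fits D H K)
    (hex : ∀ i u v, extra i u v → u ∈ ports D (Q.X (Q.start i)) (Q.X (Q.finish i)) Q.J ∧
      v ∈ ports D (Q.X (Q.start i)) (Q.X (Q.finish i)) Q.J) {u v : Port ι}
    (h : Q.Glue extra u v) : u ∈ ports D Q.x Q.y K ∧ v ∈ ports D Q.x Q.y K := by
  cases h with
  | enter j j' hj hj' =>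
    have := hQ.tail_mem_ports 0 (hQ.sub hj)
    rw [hQ.ladder.zero] at this
    exact ⟨this, hQ.rung_mem_ports _ (hQ.sub hj')⟩
  | step i j j' hi hj hj' =>
    exact ⟨hQ.head_mem_ports _ (hQ.sub hj), hQ.rung_mem_ports _ (hQ.sub hj')⟩
  | up i j l hi hj hl => exact ⟨hQ.tail_mem_ports _ (hQ.sub hj), hQ.tail_mem_ports _ (hQ.sub₁ hl)⟩
  | down i j l hi hj hl =>
    exact ⟨hQ.head_mem_ports _ (hQ.sub₀ hl), hQ.head_mem_ports _ (hQ.sub hj)⟩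
  | leave i j l hi hj hl =>
    exact ⟨hQ.tail_mem_ports _ (hQ.sub (hQ.leave_mem l hl)), hQ.head_mem_ports _ (hQ.sub hj)⟩
  | extra i _ _ hi huv =>
    have hsub := ports_mono (D := D) (hQ.ladder.bot_le (Q.start i)) (hQ.ladder.le_top (Q.finish i))
      hQ.sub
    exact ⟨hsub (hex i u v huv).1, hsub (hex i u v huv).2⟩

lemma Fits.rung_mem_below (hQ : Q.Fits D H K) {z : ι → ℕ} (hzy : z ≤ Q.y) {h : ℕ}
    (hz : ∀ j ∈ Q.J, rung Q.X Q.m Q.y h j ∈ below z) : h < Q.m ∧ ∀ j ∈ Q.J, Q.X h j ≤ z j := by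
  have hm : h < Q.m := by
    by_contra hcon
    obtain ⟨j, hj⟩ := hQ.nonempty
    have := hz j hj
    rw [rung, if_neg hcon, head_mem_below] at this
    exact absurd (hzy j) (not_le.2 this)
  refine ⟨hm, fun j hj => ?_⟩
  have := hz j hj
  rwa [rung, if_pos hm, tail_mem_below] at this

lemma Fits.not_closed_below (hQ : Q.Fits D H K) (hD : IsLat D)
    (hex : ∀ i u v, extra i u v → u ∈ ports D (Q.X (Q.start i)) (Q.X (Q.finish i)) Q.J ∧
      v ∈ ports D (Q.X (Q.start i)) (Q.X (Q.finish i)) Q.J)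
    (hkill : ∀ i z, Q.Passes D i z → ¬ Closed (extra i) (below z))
    {z : ι → ℕ} (hz : z ∈ D) (hxz : Q.x ≤ z) (hzy : z ≤ Q.y) :
    ¬ Closed (Q.Glue extra) (below z) := by
  intro hcl
  obtain ⟨j₀, hj₀⟩ := hQ.nonempty
  let P : ℕ → Prop := fun i => Q.start i < Q.m ∧ ∀ j ∈ Q.J, Q.X (Q.start i) j ≤ z j
  have hP0 : P 0 := by
    have := hQ.rung_mem_below hzy (h := Q.o) fun j hj =>
      hcl _ _ (Glue.enter j₀ j hj₀ hj) (tail_mem_below.2 (hxz j₀))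
    simpa [P, start] using this
  have hbd : ∀ i, P i → i ≤ Q.m := fun i hi => by
    have h1 := hi.1
    have h2 := Nat.mul_le_mul_left i hQ.pos
    simp only [start] at h1
    omega
  set i := Nat.findGreatest P Q.m with hi
  have hPi : P i := Nat.findGreatest_spec (P := P) (Nat.zero_le _) hP0
  have hle : ∀ j ∈ Q.J, z j ≤ Q.X (Q.finish i) j := by
    intro j hj
    by_contra! hcon
    have hP : P (i + 1) := hQ.rung_mem_below hzy fun j' hj' =>
      hcl _ _ (Glue.step i j j' hPi.1 hj hj') (head_mem_below.2 hcon)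
    have : i + 1 ≤ i := Nat.le_findGreatest (hbd _ hP) hP
    omega
  have hnot : Port.head j₀ (Q.X (Q.finish i) j₀) ∉ below z := by
    rw [head_mem_below]
    exact not_lt.2 (hle j₀ hj₀)
  have hst := hQ.start_le_finish i
  have hJ : ∀ j ∈ Q.J, ((z ⊔ Q.X (Q.start i)) ⊓ Q.X (Q.finish i)) j = z j := fun j hj => by
    rw [Pi.inf_apply, Pi.sup_apply, sup_eq_left.2 (hPi.2 j hj), inf_eq_left.2 (hle j hj)]
  refine hkill i ((z ⊔ Q.X (Q.start i)) ⊓ Q.X (Q.finish i)) ⟨?_, ?_, inf_le_right, ?_, ?_, ?_⟩ ?_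
  · exact hD.inf _ (hD.sup _ hz _ (hQ.ladder.mem _)) _ (hQ.ladder.mem _)
  · exact le_inf le_sup_right hst
  · intro l hl
    have := hcl _ _ (Glue.up i j₀ l hPi.1 hj₀ hl) (tail_mem_below.2 (hPi.2 j₀ hj₀))
    rw [tail_mem_below] at this
    rw [Pi.inf_apply, Pi.sup_apply]
    exact inf_eq_right.2 (this.trans le_sup_left)
  · intro l hl
    have : z l ≤ Q.X (Q.start i) l := by
      by_contra! hcon
      exact hnot (hcl _ _ (Glue.down i j₀ l hPi.1 hj₀ hl) (head_mem_below.2 hcon))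
    rw [Pi.inf_apply, Pi.sup_apply, sup_eq_right.2 this]
    exact inf_eq_left.2 (hst l)
  · intro l hl
    rw [hJ l (hQ.leave_mem l hl)]
    by_contra! hcon
    exact hnot (hcl _ _ (Glue.leave i j₀ l hPi.1 hj₀ hl) (tail_mem_below.2 hcon))
  · intro u v huv hu
    have hp := hex i u v huv
    rw [mem_below_congr hp.2 hJ]
    rw [mem_below_congr hp.1 hJ] at hu
    exact hcl _ _ (Glue.extra i u v hPi.1 huv) hu

/-- The run of `S` from `s` to `t` follows the plan, in the window of index `i₀`. -/
structure Follows (Q : Plan ι) (D : Finset (ι → ℕ)) (S : Set (Port ι)) (K : Finset ι) (r i₀ : ℕ)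
    (σ σ' : Finset ι) : Prop where
  run : Run D S Q.x Q.y K Q.X Q.m r (Q.start i₀) (Q.finish i₀) σ σ'
  window : Q.B = r + 2
  J_eq : Q.J = σ \ σ'
  J₁_eq : Q.J₁ = σ'
  J₀_eq : Q.J₀ = K \ σ
  leave : ∀ j ∈ Q.p, Port.tail j (Q.X (Q.start i₀ + 1) j) ∉ S

variable {S : Set (Port ι)} {r i₀ : ℕ} {σ σ' : Finset ι}

lemma Fits.closed [Fintype ι] (hQ : Q.Fits D (pattern D Q.x Q.y) K)
    (hK : ∀ j ∈ K, Q.x j < Q.y j)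
    (hex : ∀ i u v, extra i u v → u ∈ ports D (Q.X (Q.start i)) (Q.X (Q.finish i)) Q.J ∧
      v ∈ ports D (Q.X (Q.start i)) (Q.X (Q.finish i)) Q.J)
    (hS : Q.Follows D S K r i₀ σ σ') (hcl : Closed (extra i₀) S) : Closed (Q.Glue extra) S := by
  obtain ⟨hR, hB, hJe, hJ₁e, hJ₀e, hleave⟩ := hS
  have hX := hQ.ladder
  have hJσ : ∀ j ∈ Q.J, j ∈ σ := fun j hj => by
    rw [hJe] at hj; exact Finset.sdiff_subset hj
  have hJσ' : ∀ j ∈ Q.J, j ∈ K \ σ' := fun j hj => by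
    rw [hJe, Finset.mem_sdiff] at hj
    simp [hR.sub hj.1, hj.2]
  have hbefore : ∀ i, i < i₀ → Q.start (i + 1) ≤ Q.start i₀ ∧ Q.finish i < Q.start i₀ := by
    intro i hi
    have h1 := Nat.mul_le_mul_right Q.B (Nat.succ_le_of_lt hi)
    rw [Nat.succ_mul] at h1
    have h2 := hR.short
    simp only [start, finish] at *
    rw [Nat.add_mul]
    omega
  have hafter : ∀ i, i₀ < i → Q.finish i₀ < Q.start i := by
    intro i hi
    have h1 := Nat.mul_le_mul_right Q.B (Nat.succ_le_of_lt hi)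
    rw [Nat.succ_mul] at h1
    have h2 := hR.short
    simp only [start, finish] at *
    omega
  have hlow : ∀ i, i < i₀ → ∀ j ∈ Q.J, Q.X (Q.finish i) j < Q.X (Q.start i₀) j :=
    fun i hi j hj => hX.lt (hbefore i hi).2 hR.lt_top (diag_mem_pattern (hK j (hQ.sub hj)))
  have hhigh : ∀ i, i₀ < i → Q.start i < Q.m → ∀ j ∈ Q.J,
      Q.X (Q.finish i₀) j < Q.X (Q.start i) j :=
    fun i hi him j hj => hX.lt (hafter i hi) him (diag_mem_pattern (hK j (hQ.sub hj)))
  have hXm := hX.mem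
  have hXb := hX.bot_le
  have hXt := hX.le_top
  have hheadlow : ∀ i, i < i₀ → ∀ j ∈ Q.J, Port.head j (Q.X (Q.finish i) j) ∈ S :=
    fun i hi j hj => (hR.inBelow j (hJσ j hj) _ (hXm _) (hXb _) (hXt _)).2 (hlow i hi j hj)
  have hheadhigh : ∀ i, i₀ ≤ i → ∀ j ∈ Q.J, Port.head j (Q.X (Q.finish i) j) ∉ S := by
    intro i hi j hj
    refine (hR.outAbove' j (hJσ' j hj) _ (hXm _) (hXb _) (hXt _)).1 (hX.mono ?_ j)
    have := Nat.mul_le_mul_right Q.B hi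
    simp only [start, finish]
    omega
  have htailhigh : ∀ i, i₀ < i → Q.start i < Q.m → ∀ j ∈ Q.J, ∀ n, Q.start i ≤ n →
      Port.tail j (Q.X n j) ∉ S := fun i hi him j hj n hn =>
    (hR.outAbove' j (hJσ' j hj) _ (hXm _) (hXb _) (hXt _)).2
      ((hhigh i hi him j hj).trans_le (hX.mono hn j))
  have hrung : ∀ h, h ≤ Q.start i₀ → ∀ j ∈ Q.J, rung Q.X Q.m Q.y h j ∈ S := by
    intro h hh j hj
    rw [rung, if_pos (hh.trans_lt hR.lt_top)]
    exact (hR.inBelow j (hJσ j hj) _ (hXm _) (hXb _) (hXt _)).1 (hX.mono hh j)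
  intro u v huv hu
  cases huv with
  | enter j j' hj hj' => exact hrung _ (by simp [start]) j' hj'
  | step i j j' hi hj hj' =>
    rcases lt_or_ge i i₀ with h | h
    · exact hrung _ (hbefore i h).1 j' hj'
    · exact absurd hu (hheadhigh i h j hj)
  | up i j l hi hj hl =>
    rcases le_or_gt i i₀ with h | h
    · rw [hJ₁e] at hl
      refine (hR.inBelow' l hl _ (hXm _) (hXb _) (hXt _)).1 (hX.mono ?_ l)
      have := Nat.mul_le_mul_right Q.B h
      simp only [start, finish]
      omega
    · exact absurd hu (htailhigh i h hi j hj _ le_rfl)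
  | down i j l hi hj hl =>
    rcases lt_or_ge i i₀ with h | h
    · exact hheadlow i h j hj
    · rw [hJ₀e] at hl
      refine absurd hu ((hR.outAbove l hl _ (hXm _) (hXb _) (hXt _)).1 (hX.mono ?_ l))
      have := Nat.mul_le_mul_right Q.B h
      simp only [start]
      omega
  | leave i j l hi hj hl =>
    rcases lt_trichotomy i i₀ with h | rfl | h
    · exact hheadlow i h j hj
    · exact absurd hu (hleave l hl)
    · exact absurd hu (htailhigh i h hi l (hQ.leave_mem l hl) _ (Nat.le_succ _))
  | extra i _ _ hi huv =>
    rcases lt_trichotomy i i₀ with h | rfl | h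
    · obtain ⟨j, hj, w, hw, h1, h2, h3⟩ := (hex i u v huv).2
      have := hR.inBelow j (hJσ j hj) w hw ((hXb _).trans h1) (h2.trans (hXt _))
      have hlt := (h2 j).trans_lt (hlow i h j hj)
      rcases h3 with rfl | rfl
      · exact this.1 hlt.le
      · exact this.2 hlt
    · exact hcl u v huv hu
    · obtain ⟨j, hj, w, hw, h1, h2, h3⟩ := (hex i u v huv).1
      have := hR.outAbove' j (hJσ' j hj) w hw ((hXb _).trans h1) (h2.trans (hXt _))
      have hlt := (hhigh i h hi j hj).trans_le (h1 j)
      rcases h3 with rfl | rfl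
      · exact absurd hu (this.2 hlt)
      · exact absurd hu (this.1 hlt.le)

end Plan
end Chains

section Chains
variable {ι : Type}

lemma pattern_subset [Fintype ι] {D : Finset (ι → ℕ)} (hD : IsLat D) {x y a b : ι → ℕ}
    (ha : a ∈ D) (hb : b ∈ D) (hxa : x ≤ a) (hab : a ≤ b) (hby : b ≤ y) :
    pattern D a b ⊆ pattern D x y := by
  intro e he
  rw [mem_pattern] at he ⊢
  rintro w hw hxw hwy ⟨h1, h2⟩
  refine he ((w ⊔ a) ⊓ b) (hD.inf _ (hD.sup _ hw _ ha) _ hb) (le_inf le_sup_right hab)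
    inf_le_right ⟨?_, ?_⟩
  · rw [Pi.inf_apply, Pi.sup_apply, h1]
    exact inf_eq_right.2 ((hby e.1).trans le_sup_left)
  · rw [Pi.inf_apply, Pi.sup_apply, h2, sup_eq_right.2 (hxa e.2)]
    exact inf_eq_left.2 (hab e.2)

namespace Plan

variable {Q : Plan ι} {D : Finset (ι → ℕ)} {K : Finset ι} {S : Set (Port ι)}

lemma Follows.admissible {r i₀ : ℕ} {σ σ' : Finset ι} (hF : Q.Follows D S K r i₀ σ σ')
    (hD : IsLat D) (hS : Admissible D S Q.x Q.y K) {H : Finset (ι × ι)} (hQ : Q.Fits D H K)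
    {a b : ι → ℕ} (hXa : Q.X (Q.start i₀) ≤ a)
    (hbX : b ≤ Q.X (Q.finish i₀)) (htail : ∀ j ∈ Q.J, Port.tail j (a j) ∈ S)
    (hhead : ∀ j ∈ Q.J, Port.head j (b j) ∉ S) : Admissible D S a b Q.J := by
  obtain ⟨hR, hB, hJe, hJ₁e, hJ₀e, hleave⟩ := hF
  have hJσ : ∀ j ∈ Q.J, j ∈ σ ∧ j ∉ σ' := fun j hj => by
    rwa [hJe, Finset.mem_sdiff] at hj
  have hxa := (hQ.ladder.bot_le (Q.start i₀)).trans hXa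
  have hby := hbX.trans (hQ.ladder.le_top (Q.finish i₀))
  refine ⟨htail, hhead, fun z hz haz hzb => ?_, ?_, ?_⟩
  · rw [hJe]
    exact hR.no_transversal z hz (hXa.trans haz) (hzb.trans hbX)
  · intro z hz haz hzb hzS w hw haw hwb j hj
    refine hS.inBelow hD hR.sub hR.split hz (hxa.trans haz) (hzb.trans hby) (fun l hl => ?_) j
      (hJσ j hj).1 w hw (hxa.trans haw) (hwb.trans hby)
    by_cases hl' : l ∈ σ'
    · exact (hR.inBelow' l hl' z hz (hxa.trans haz) (hzb.trans hby)).1 ((hzb.trans hbX) l)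
    · exact hzS l (by simp [hJe, hl, hl'])
  · intro z hz haz hzb hzS w hw haw hwb j hj
    refine hS.outAbove hD hR.split' hz (hxa.trans haz) (hzb.trans hby) (fun l hl => ?_) j
      (by simp [hQ.sub hj, (hJσ j hj).2]) w hw (hxa.trans haw) (hwb.trans hby)
    rw [Finset.mem_sdiff] at hl
    by_cases hl' : l ∈ σ
    · exact hzS l (by simp [hJe, hl, hl'])
    · exact (hR.outAbove l (by simp [hl.1, hl']) z hz (hxa.trans haz) (hzb.trans hby)).1
        ((hXa.trans haz) l)

lemma exists_passes_bounds (Q : Plan ι) (hD : IsLat D) (i : ℕ) : ∃ a b, ∀ z, Q.Passes D i z →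
    Q.Passes D i a ∧ Q.Passes D i b ∧ a ≤ z ∧ z ≤ b := by
  by_cases hex : ∃ z, Q.Passes D i z
  · obtain ⟨z, hz, hz'⟩ := hex
    obtain ⟨a, ha, ha', hmin⟩ := hD.exists_inf (P := fun z => Q.X (Q.start i) ≤ z ∧
        z ≤ Q.X (Q.finish i) ∧ (∀ l ∈ Q.J₁, z l = Q.X (Q.finish i) l) ∧
        (∀ l ∈ Q.J₀, z l = Q.X (Q.start i) l) ∧ ∀ j ∈ Q.p, z j < Q.X (Q.start i + 1) j) (by
      rintro u v ⟨hu1, hu2, hu3, hu4, hu5⟩ ⟨hv1, hv2, hv3, hv4, hv5⟩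
      refine ⟨le_inf hu1 hv1, inf_le_left.trans hu2, fun l hl => ?_, fun l hl => ?_,
        fun l hl => inf_le_left.trans_lt (hu5 l hl)⟩
      · rw [Pi.inf_apply, hu3 l hl, hv3 l hl, inf_idem]
      · rw [Pi.inf_apply, hu4 l hl, hv4 l hl, inf_idem]) hz hz'
    obtain ⟨b, hb, hb', hmax⟩ := hD.exists_sup (P := fun z => Q.X (Q.start i) ≤ z ∧
        z ≤ Q.X (Q.finish i) ∧ (∀ l ∈ Q.J₁, z l = Q.X (Q.finish i) l) ∧
        (∀ l ∈ Q.J₀, z l = Q.X (Q.start i) l) ∧ ∀ j ∈ Q.p, z j < Q.X (Q.start i + 1) j) (by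
      rintro u v ⟨hu1, hu2, hu3, hu4, hu5⟩ ⟨hv1, hv2, hv3, hv4, hv5⟩
      refine ⟨hu1.trans le_sup_left, sup_le hu2 hv2, fun l hl => ?_, fun l hl => ?_,
        fun l hl => sup_lt_iff.2 ⟨hu5 l hl, hv5 l hl⟩⟩
      · rw [Pi.sup_apply, hu3 l hl, hv3 l hl, sup_idem]
      · rw [Pi.sup_apply, hu4 l hl, hv4 l hl, sup_idem]) hz hz'
    exact ⟨a, b, fun w hw => ⟨⟨ha, ha'⟩, ⟨hb, hb'⟩, hmin w hw.1 hw.2, hmax w hw.1 hw.2⟩⟩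
  · push Not at hex
    exact ⟨Q.x, Q.y, fun z hz => absurd hz (hex z)⟩

/-- A proper subinterval on which the cuts pass through a window has a smaller pattern. -/
lemma Fits.pattern_ssubset [Fintype ι] (hQ : Q.Fits D (pattern D Q.x Q.y) K) (hD : IsLat D)
    (hK : ∀ j ∈ K, Q.x j < Q.y j) (hcov : ∀ j ∈ K, j ∈ Q.J ∨ j ∈ Q.J₁ ∨ j ∈ Q.J₀)
    (hp : Q.J = K → Q.p.isSome) {i : ℕ} {a b : ι → ℕ} (ha : Q.Passes D i a)
    (hb : Q.Passes D i b) (hab : a ≤ b) : pattern D a b ⊂ pattern D Q.x Q.y := by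
  obtain ⟨haD, ha1, ha2, ha3, ha4, ha5⟩ := ha
  obtain ⟨hbD, hb1, hb2, hb3, hb4, hb5⟩ := hb
  have hxa := (hQ.ladder.bot_le (Q.start i)).trans ha1
  have hby := hb2.trans (hQ.ladder.le_top (Q.finish i))
  refine (pattern_subset hD haD hbD hxa hab hby).ssubset_of_ne fun heq => ?_
  by_cases hJ : Q.J = K
  · obtain ⟨l, hl⟩ := Option.isSome_iff_exists.1 (hp hJ)
    refine absurd (hQ.ladder.least (Q.start i) b hbD hb1 hby ?_ l) (not_le.2 (hb5 l hl))
    intro e he w hw h1 h2 h3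
    rw [← heq, mem_pattern] at he
    refine he (w ⊔ a) (hD.sup _ hw _ haD) le_sup_right (sup_le h2 hab) ⟨?_, ?_⟩
    · rw [Pi.sup_apply, h3.1, sup_eq_left.2 (hab e.1)]
    · rw [Pi.sup_apply, h3.2, sup_eq_right.2 (ha1 e.2)]
  · obtain ⟨l, hlK, hlJ⟩ := Finset.exists_of_ssubset (hQ.sub.ssubset_of_ne hJ)
    have hmem := diag_mem_pattern (D := D) (hK l hlK)
    rw [← heq, mem_pattern] at hmem
    refine hmem a haD le_rfl hab ⟨?_, rfl⟩
    rcases (hcov l hlK).resolve_left hlJ with h | h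
    · rw [ha3 l h, hb3 l h]
    · rw [ha4 l h, hb4 l h]

/-- Arcs dealing with the cuts passing through a window between `a i` and `b i`. -/
def windowArcs (Q : Plan ι) (a b : ℕ → ι → ℕ)
    (F : ℕ → Port ι → Port ι → Prop) (i : ℕ) (u v : Port ι) : ι ⊕ ι ⊕ Unit → Prop
  | Sum.inl l => ∃ j' ∈ Q.J, (l ∈ Q.J → j' = l) ∧ u = Port.tail j' (a i j') ∧
      ∃ j ∈ Q.J, v = Port.head j (Q.X (Q.finish i) j)
  | Sum.inr (Sum.inl l) => ∃ j' ∈ Q.J, (l ∈ Q.J → j' = l) ∧ v = Port.head j' (b i j') ∧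
      ∃ j ∈ Q.J, u = Port.tail j (Q.X (Q.start i) j)
  | Sum.inr (Sum.inr _) => F i u v

end Plan

/-- A family of relations on the ports on `K` between `x` and `y`, none of which leaves any cut
between `x` and `y` closed, such that each admissible set is closed under one of them. -/
structure Separating (r : ℕ) (D : Finset (ι → ℕ)) (x y : ι → ℕ) (K : Finset ι) {Γ : Type}
    (F : Γ → Port ι → Port ι → Prop) : Prop where
  mem_ports : ∀ g u v, F g u v → u ∈ ports D x y K ∧ v ∈ ports D x y K
  not_closed : ∀ g, ∀ z ∈ D, x ≤ z → z ≤ y → ¬ Closed (F g) (below z)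
  exists_closed : ∀ S, FewUnclean r D S → Admissible D S x y K → ∃ g, Closed (F g) S

lemma Plan.Fits.exists_family [Fintype ι] {Q : Plan ι} {D : Finset (ι → ℕ)} {K : Finset ι}
    (hQ : Q.Fits D (pattern D Q.x Q.y) K) (hD : IsLat D)
    (hK : ∀ j ∈ K, Q.x j < Q.y j) (hK' : ∀ j, j ∉ K → Q.x j = Q.y j)
    (hcov : ∀ j ∈ K, j ∈ Q.J ∨ j ∈ Q.J₁ ∨ j ∈ Q.J₀) (hp : Q.J = K → Q.p.isSome)
    {Γ : Type} {r d : ℕ} (hd : (pattern D Q.x Q.y).card ≤ d + 1)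
    (ih : ∀ a ∈ D, ∀ b ∈ D, a ≤ b → ∀ J : Finset ι, J.Nonempty → (∀ j, j ∉ J → a j = b j) →
      (pattern D a b).card ≤ d → ∃ F : Γ → Port ι → Port ι → Prop, Separating r D a b J F) :
    ∃ F : (ι ⊕ ι ⊕ Unit) × Γ → Port ι → Port ι → Prop,
      (∀ g u v, F g u v → u ∈ ports D Q.x Q.y K ∧ v ∈ ports D Q.x Q.y K) ∧
      (∀ g, ∀ z ∈ D, Q.x ≤ z → z ≤ Q.y → ¬ Closed (F g) (below z)) ∧
      ∀ S i₀ σ σ', FewUnclean r D S → Admissible D S Q.x Q.y K → Q.Follows D S K r i₀ σ σ' →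
        Nonempty Γ → ∃ g, Closed (F g) S := by
  choose a b hab using fun i => Q.exists_passes_bounds hD i
  have hF : ∀ i, ∃ F : Γ → Port ι → Port ι → Prop,
      (∃ z, Q.Passes D i z) → Separating r D (a i) (b i) Q.J F := by
    intro i
    by_cases hex : ∃ z, Q.Passes D i z
    · obtain ⟨z, hz⟩ := hex
      obtain ⟨ha, hb, h1, h2⟩ := hab i z hz
      have hlt := Finset.card_lt_card
        (hQ.pattern_ssubset hD hK hcov hp ha hb (h1.trans h2))
      obtain ⟨F, hF⟩ := ih (a i) ha.1 (b i) hb.1 (h1.trans h2) Q.J hQ.nonempty (by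
        intro l hl
        by_cases hlK : l ∈ K
        · rcases (hcov l hlK).resolve_left hl with h | h
          · rw [ha.2.2.2.1 l h, hb.2.2.2.1 l h]
          · rw [ha.2.2.2.2.1 l h, hb.2.2.2.2.1 l h]
        · have h3 : Q.x l ≤ a i l := ((hQ.ladder.bot_le (Q.start i)).trans ha.2.1) l
          have h4 : b i l ≤ Q.y l := (hb.2.2.1.trans (hQ.ladder.le_top (Q.finish i))) l
          have h5 := hK' l hlK
          have h6 : a i l ≤ b i l := (h1.trans h2) l
          omega) (by omega)
      exact ⟨F, fun _ => hF⟩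
    · exact ⟨fun _ _ _ => False, fun h => absurd h hex⟩
  choose F hF using hF
  have hports : ∀ (g : (ι ⊕ ι ⊕ Unit) × Γ) (i : ℕ) (u v : Port ι), (∃ z, Q.Passes D i z) ∧
      Q.windowArcs a b (fun i => F i g.2) i u v g.1 →
      u ∈ ports D (Q.X (Q.start i)) (Q.X (Q.finish i)) Q.J ∧
      v ∈ ports D (Q.X (Q.start i)) (Q.X (Q.finish i)) Q.J := by
    rintro ⟨c, g⟩ i u v ⟨⟨z, hz⟩, h⟩
    obtain ⟨ha, hb, -, -⟩ := hab i z hz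
    have hXs := hQ.start_le_finish i
    match c, h with
    | Sum.inl l, h =>
      obtain ⟨j', hj', -, rfl, j, hj, rfl⟩ := h
      exact ⟨⟨j', hj', a i, ha.1, ha.2.1, ha.2.2.1, Or.inl rfl⟩,
        ⟨j, hj, _, hQ.ladder.mem _, hXs, le_rfl, Or.inr rfl⟩⟩
    | Sum.inr (Sum.inl l), h =>
      obtain ⟨j', hj', -, rfl, j, hj, rfl⟩ := h
      exact ⟨⟨j, hj, _, hQ.ladder.mem _, le_rfl, hXs, Or.inl rfl⟩,
        ⟨j', hj', b i, hb.1, hb.2.1, hb.2.2.1, Or.inr rfl⟩⟩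
    | Sum.inr (Sum.inr _), h =>
      have hsub := ports_mono (D := D) ha.2.1 hb.2.2.1 (le_refl Q.J)
      have := (hF i ⟨z, hz⟩).mem_ports g u v h
      exact ⟨hsub this.1, hsub this.2⟩
  refine ⟨fun g => Q.Glue fun i u v => (∃ z, Q.Passes D i z) ∧
      Q.windowArcs a b (fun i => F i g.2) i u v g.1, ?_, ?_, ?_⟩
  · intro g u v h
    exact hQ.glue_mem_ports (hports g) h
  · intro g z hz hxz hzy
    refine hQ.not_closed_below hD (hports g) (fun i w hw hcl => ?_) hz hxz hzy
    obtain ⟨ha, hb, haw, hwb⟩ := hab i w hw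
    obtain ⟨j₀, hj₀⟩ := hQ.nonempty
    obtain ⟨c, g⟩ := g
    match c, hcl with
    | Sum.inl l, hcl =>
      obtain ⟨j', hj', hj'l⟩ : ∃ j' ∈ Q.J, l ∈ Q.J → j' = l := by
        by_cases hl : l ∈ Q.J
        · exact ⟨l, hl, fun _ => rfl⟩
        · exact ⟨j₀, hj₀, fun h => absurd h hl⟩
      have := hcl _ _ ⟨⟨w, hw⟩, j', hj', hj'l, rfl, j₀, hj₀, rfl⟩ (tail_mem_below.2 (haw j'))
      exact absurd (hw.2.2.1 j₀) (not_le.2 (head_mem_below.1 this))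
    | Sum.inr (Sum.inl l), hcl =>
      obtain ⟨j', hj', hj'l⟩ : ∃ j' ∈ Q.J, l ∈ Q.J → j' = l := by
        by_cases hl : l ∈ Q.J
        · exact ⟨l, hl, fun _ => rfl⟩
        · exact ⟨j₀, hj₀, fun h => absurd h hl⟩
      have := hcl _ _ ⟨⟨w, hw⟩, j', hj', hj'l, rfl, j₀, hj₀, rfl⟩ (tail_mem_below.2 (hw.2.1 j₀))
      exact absurd (hwb j') (not_le.2 (head_mem_below.1 this))
    | Sum.inr (Sum.inr _), hcl =>
      exact (hF i ⟨w, hw⟩).not_closed g w hw.1 haw hwb fun u v huv hu =>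
        hcl u v ⟨⟨w, hw⟩, huv⟩ hu
  · rintro S i₀ σ σ' hr hS hfol ⟨g₀⟩
    have key : ∃ g : (ι ⊕ ι ⊕ Unit) × Γ, (∃ z, Q.Passes D i₀ z) →
        Closed (fun u v => Q.windowArcs a b (fun i => F i g.2) i₀ u v g.1) S := by
      by_cases hex : ∃ z, Q.Passes D i₀ z
      swap
      · exact ⟨(Sum.inr (Sum.inr ()), g₀), fun h => absurd h hex⟩
      obtain ⟨z, hz⟩ := hex
      obtain ⟨ha, hb, haz, hzb⟩ := hab i₀ z hz
      by_cases hlow : ∃ l ∈ Q.J, Port.tail l (a i₀ l) ∉ S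
      · obtain ⟨l, hl, hlS⟩ := hlow
        refine ⟨(Sum.inl l, g₀), fun _ u v huv hu => ?_⟩
        obtain ⟨j', -, hj'l, rfl, -⟩ := huv
        rw [hj'l hl] at hu
        exact absurd hu hlS
      by_cases hupp : ∃ l ∈ Q.J, Port.head l (b i₀ l) ∈ S
      · obtain ⟨l, hl, hlS⟩ := hupp
        refine ⟨(Sum.inr (Sum.inl l), g₀), fun _ u v huv hu => ?_⟩
        obtain ⟨j', -, hj'l, rfl, -⟩ := huv
        rw [hj'l hl]
        exact hlS
      push Not at hlow hupp
      obtain ⟨g, hg⟩ := (hF i₀ ⟨z, hz⟩).exists_closed S hr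
        (hfol.admissible hD hS hQ ha.2.1 hb.2.2.1 hlow hupp)
      exact ⟨(Sum.inr (Sum.inr ()), g), fun _ => hg⟩
    obtain ⟨g, hg⟩ := key
    exact ⟨g, hQ.closed hK (hports g) hfol fun u v huv hu => hg huv.1 u v huv.2 hu⟩

/-- The possible choices made at one level of the construction of a separating family. -/
abbrev Guess (ι : Type) (r : ℕ) : Type :=
  (ι → Fin 3) × Fin (r + 2) × Fin (r + 2) × Option ι × (ι ⊕ ι ⊕ Unit)

lemma Admissible.restrict {D : Finset (ι → ℕ)} {S : Set (Port ι)} {x y : ι → ℕ} {K J : Finset ι}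
    (hS : Admissible D S x y K) (hJK : J ⊆ K) (hJ : ∀ j ∈ K, j ∉ J → x j = y j) :
    Admissible D S x y J := by
  have hz : ∀ z, x ≤ z → z ≤ y → ∀ j ∈ K, j ∉ J → z j = x j ∧ z j = y j := fun z h1 h2 j hj hjJ =>
    have := hJ j hj hjJ
    have : x j ≤ z j := h1 j
    have : z j ≤ y j := h2 j
    ⟨by omega, by omega⟩
  refine ⟨fun j hj => hS.tail_mem j (hJK hj), fun j hj => hS.head_notMem j (hJK hj), ?_, ?_, ?_⟩
  · intro z hzD h1 h2 htr
    refine hS.no_transversal z hzD h1 h2 fun j hj => ?_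
    by_cases hjJ : j ∈ J
    · exact htr j hjJ
    · have := hz z h1 h2 j hj hjJ
      refine ⟨?_, ?_⟩
      · rw [this.1]; exact hS.tail_mem j hj
      · rw [this.2]; exact hS.head_notMem j hj
  · intro z hzD h1 h2 htr w hw hxw hwy j hj
    refine hS.down z hzD h1 h2 (fun l hl => ?_) w hw hxw hwy j (hJK hj)
    by_cases hlJ : l ∈ J
    · exact htr l hlJ
    · rw [(hz z h1 h2 l hl hlJ).1]; exact hS.tail_mem l hl
  · intro z hzD h1 h2 htr w hw hxw hwy j hj
    refine hS.up z hzD h1 h2 (fun l hl => ?_) w hw hxw hwy j (hJK hj)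
    by_cases hlJ : l ∈ J
    · exact htr l hlJ
    · rw [(hz z h1 h2 l hl hlJ).2]; exact hS.head_notMem l hl

/-- Arcs joining the two ends of the interval from `x` to `y` on each chain. -/
def spanArcs (x y : ι → ℕ) (K : Finset ι) (u v : Port ι) : Prop :=
  ∃ j ∈ K, u = Port.tail j (x j) ∧ v = Port.head j (y j)

lemma spanArcs_mem_ports {D : Finset (ι → ℕ)} {x y : ι → ℕ} (hx : x ∈ D) (hy : y ∈ D)
    (hxy : x ≤ y) {K : Finset ι} {u v : Port ι} (h : spanArcs x y K u v) :
    u ∈ ports D x y K ∧ v ∈ ports D x y K := by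
  obtain ⟨j, hj, rfl, rfl⟩ := h
  exact ⟨⟨j, hj, x, hx, le_rfl, hxy, Or.inl rfl⟩, ⟨j, hj, y, hy, hxy, le_rfl, Or.inr rfl⟩⟩

lemma not_closed_spanArcs {x y z : ι → ℕ} {K : Finset ι} (hK : K.Nonempty) (hxz : x ≤ z)
    (hzy : z ≤ y) : ¬ Closed (spanArcs x y K) (below z) := by
  obtain ⟨j, hj⟩ := hK
  intro hcl
  have := hcl _ _ ⟨j, hj, rfl, rfl⟩ (tail_mem_below.2 (hxz j))
  exact absurd (hzy j) (not_le.2 (head_mem_below.1 this))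

lemma separating_of_forall_eq {D : Finset (ι → ℕ)} (r : ℕ) {x y : ι → ℕ} (hx : x ∈ D)
    (hy : y ∈ D) (hxy : x ≤ y) {K : Finset ι} (hK : K.Nonempty) (h : ∀ j ∈ K, x j = y j)
    (Γ : Type) : Separating r D x y K fun (_ : Γ) => spanArcs x y K where
  mem_ports := fun _ _ _ h => spanArcs_mem_ports hx hy hxy h
  not_closed := fun _ _ _ h1 h2 => not_closed_spanArcs hK h1 h2
  exists_closed := fun S _ hS => by
    refine absurd (fun j hj => ⟨hS.tail_mem j hj, ?_⟩) (hS.no_transversal x hx le_rfl hxy)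
    rw [h j hj]
    exact hS.head_notMem j hj

lemma Separating.extend {r : ℕ} {D : Finset (ι → ℕ)} {x y : ι → ℕ} {J K : Finset ι} {Γ : Type}
    {F : Γ → Port ι → Port ι → Prop} (h : Separating r D x y J F) (hJK : J ⊆ K)
    (hJ : ∀ j ∈ K, j ∉ J → x j = y j) : Separating r D x y K F where
  mem_ports := fun g u v huv =>
    have hsub := ports_mono (D := D) (le_refl x) (le_refl y) hJK
    ⟨hsub (h.mem_ports g u v huv).1, hsub (h.mem_ports g u v huv).2⟩
  not_closed := h.not_closed
  exists_closed := fun S hr hS => h.exists_closed S hr (hS.restrict hJK hJ)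

/-- The plan determined by a guess. -/
noncomputable def guessPlan (X : ℕ → ι → ℕ) (m : ℕ) (x y : ι → ℕ) (K : Finset ι) (r : ℕ)
    (c : ι → Fin 3) (o L : Fin (r + 2)) (p : Option ι) : Plan ι where
  X := X
  m := m
  x := x
  y := y
  J := K.filter fun j => c j = 0
  J₁ := K.filter fun j => c j = 1
  J₀ := K.filter fun j => c j = 2
  p := p
  o := o
  L := L
  B := r + 2

/-- Every admissible set follows the plan of some guess. -/
lemma exists_guess [Fintype ι] {D : Finset (ι → ℕ)} (hD : IsLat D) {x y : ι → ℕ} (hx : x ∈ D)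
    (hy : y ∈ D) (hxy : x ≤ y) {K : Finset ι} (hK : ∀ j ∈ K, x j < y j) {X : ℕ → ι → ℕ} {m : ℕ}
    (hX : Ladder D (pattern D x y) x y X m) {r : ℕ} {S : Set (Port ι)} (hr : FewUnclean r D S)
    (hS : Admissible D S x y K) : ∃ c o L p i₀ σ σ',
      (guessPlan X m x y K r c o L p).Follows D S K r i₀ σ σ' ∧
      (guessPlan X m x y K r c o L p).J.Nonempty ∧
      (∀ j ∈ p, j ∈ (guessPlan X m x y K r c o L p).J) ∧
      ((guessPlan X m x y K r c o L p).J = K → p.isSome) := by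
  obtain ⟨s, t, σ, σ', hR⟩ := exists_run hS hr hD hx hy hxy hK hX
  have hJ : (σ \ σ').Nonempty := by
    rw [Finset.nonempty_iff_ne_empty]
    intro h
    exact hR.no_transversal (X s) (hX.mem s) le_rfl (hX.mono hR.le) (by simp [h])
  have hp : ∃ p : Option ι, (∀ j ∈ p, j ∈ σ \ σ' ∧ Port.tail j (X (s + 1) j) ∉ S) ∧
      (σ \ σ' = K → p.isSome) := by
    by_cases h : σ \ σ' = K
    · obtain ⟨j, hj, hjS⟩ := hR.leave h
      exact ⟨some j, by simpa [← h] using ⟨by simpa [← h] using hj, hjS⟩, by simp⟩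
    · exact ⟨none, by simp, fun h' => absurd h' h⟩
  obtain ⟨p, hp1, hp2⟩ := hp
  let c : ι → Fin 3 := fun j => if j ∈ σ then if j ∈ σ' then 1 else 0 else 2
  let o : Fin (r + 2) := ⟨s % (r + 2), Nat.mod_lt _ (by omega)⟩
  let L : Fin (r + 2) := ⟨t - s, by have := hR.short; omega⟩
  let Q := guessPlan X m x y K r c o L p
  have hstart : Q.start (s / (r + 2)) = s := by
    simp only [Plan.start, Q, guessPlan, o]
    exact Nat.mod_add_div' _ _
  have hfinish : Q.finish (s / (r + 2)) = t := by
    rw [Plan.finish, hstart]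
    simp only [Q, guessPlan, L]
    have := hR.le
    omega
  have hJe : Q.J = σ \ σ' := by
    ext j
    have hsub := @hR.sub j
    simp only [Q, guessPlan, c, Finset.mem_filter, Finset.mem_sdiff]
    split_ifs with h1 h2 <;> simp_all
  have hJ₁e : Q.J₁ = σ' := by
    ext j
    have hsub := @hR.sub j
    have hsub' := @hR.sub' j
    simp only [Q, guessPlan, c, Finset.mem_filter]
    split_ifs with h1 h2 <;> simp_all
  have hJ₀e : Q.J₀ = K \ σ := by
    ext j
    simp only [Q, guessPlan, c, Finset.mem_filter, Finset.mem_sdiff]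
    split_ifs with h1 h2 <;> simp_all
  refine ⟨c, o, L, p, s / (r + 2), σ, σ', ⟨?_, rfl, hJe, hJ₁e, hJ₀e, ?_⟩, ?_, ?_, ?_⟩
  · change Run D S x y K X m r (Q.start _) (Q.finish _) σ σ'
    rw [hstart, hfinish]
    exact hR
  · intro j hj
    change Port.tail j (X (Q.start _ + 1) j) ∉ S
    rw [hstart]
    exact (hp1 j hj).2
  · change Q.J.Nonempty
    rwa [hJe]
  · intro j hj
    change j ∈ Q.J
    rw [hJe]
    exact (hp1 j hj).1
  · change Q.J = K → _
    rwa [hJe]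

theorem exists_separating [Fintype ι] {D : Finset (ι → ℕ)} (hD : IsLat D) (r d : ℕ) :
    ∀ x ∈ D, ∀ y ∈ D, x ≤ y → ∀ K : Finset ι, K.Nonempty → (∀ j, j ∉ K → x j = y j) →
      (pattern D x y).card ≤ d →
      ∃ F : (Fin d → Guess ι r) → Port ι → Port ι → Prop, Separating r D x y K F := by
  induction d with
  | zero =>
    intro x hx y hy hxy K hK hKe hd
    refine ⟨_, separating_of_forall_eq r hx hy hxy hK (fun j _ => ?_) _⟩
    by_contra hne
    have := diag_mem_pattern (D := D) (lt_of_le_of_ne (hxy j) hne)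
    rw [Finset.card_eq_zero.1 (Nat.le_zero.1 hd)] at this
    simp at this
  | succ d ih =>
    intro x hx y hy hxy K hK hKe hd
    by_cases hall : ∀ j ∈ K, x j = y j
    · exact ⟨_, separating_of_forall_eq r hx hy hxy hK hall _⟩
    push Not at hall
    obtain ⟨j₀, hj₀K, hj₀⟩ := hall
    suffices h : ∃ F : (Fin (d + 1) → Guess ι r) → Port ι → Port ι → Prop,
        Separating r D x y (K.filter fun j => x j < y j) F by
      obtain ⟨F, hF⟩ := h
      refine ⟨F, hF.extend (Finset.filter_subset _ _) fun j hj hjn => ?_⟩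
      by_contra hne
      exact hjn (Finset.mem_filter.2 ⟨hj, lt_of_le_of_ne (hxy j) hne⟩)
    have hlt : x j₀ < y j₀ := lt_of_le_of_ne (hxy j₀) hj₀
    have hK₀ : (K.filter fun j => x j < y j).Nonempty := ⟨j₀, Finset.mem_filter.2 ⟨hj₀K, hlt⟩⟩
    have hK₀lt : ∀ j ∈ K.filter fun j => x j < y j, x j < y j := fun j hj =>
      (Finset.mem_filter.1 hj).2
    have hK₀e : ∀ j, j ∉ K.filter (fun j => x j < y j) → x j = y j := by
      intro j hj
      by_contra hne
      by_cases hjK : j ∈ K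
      · exact hj (Finset.mem_filter.2 ⟨hjK, lt_of_le_of_ne (hxy j) hne⟩)
      · exact hne (hKe j hjK)
    generalize K.filter (fun j => x j < y j) = K₀ at hK₀ hK₀lt hK₀e
    obtain ⟨X, m, hX⟩ := exists_ladder hD hx hy hxy (diag_mem_pattern (D := D) hlt) hlt
    have key : ∀ c o L p, ∃ F : (ι ⊕ ι ⊕ Unit) × (Fin d → Guess ι r) → Port ι → Port ι → Prop,
        (∀ g u v, F g u v → u ∈ ports D x y K₀ ∧ v ∈ ports D x y K₀) ∧
        (∀ g, ∀ z ∈ D, x ≤ z → z ≤ y → ¬ Closed (F g) (below z)) ∧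
        ∀ S i₀ σ σ', FewUnclean r D S → Admissible D S x y K₀ →
          (guessPlan X m x y K₀ r c o L p).Follows D S K₀ r i₀ σ σ' →
          (guessPlan X m x y K₀ r c o L p).J.Nonempty →
          (∀ j ∈ p, j ∈ (guessPlan X m x y K₀ r c o L p).J) →
          ((guessPlan X m x y K₀ r c o L p).J = K₀ → p.isSome) →
          Nonempty (Fin d → Guess ι r) → ∃ g, Closed (F g) S := by
      intro c o L p
      by_cases hval : (guessPlan X m x y K₀ r c o L p).J.Nonempty ∧
          (∀ j ∈ p, j ∈ (guessPlan X m x y K₀ r c o L p).J) ∧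
          ((guessPlan X m x y K₀ r c o L p).J = K₀ → p.isSome)
      · obtain ⟨h1, h2, h3⟩ := hval
        have hfits : (guessPlan X m x y K₀ r c o L p).Fits D (pattern D x y) K₀ :=
          ⟨hX, hx, hy, hxy, h1, Finset.filter_subset _ _, Finset.filter_subset _ _,
            Finset.filter_subset _ _, h2, Nat.succ_pos _⟩
        obtain ⟨F, hF1, hF2, hF3⟩ := hfits.exists_family hD hK₀lt hK₀e (fun j hj => by
          simp only [guessPlan, Finset.mem_filter, hj, true_and]
          generalize c j = n
          fin_cases n <;> simp) h3 hd ih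
        exact ⟨F, hF1, hF2, fun S i₀ σ σ' hr hS hfol _ _ _ hne => hF3 S i₀ σ σ' hr hS hfol hne⟩
      · exact ⟨fun _ => spanArcs x y K₀, fun _ _ _ h => spanArcs_mem_ports hx hy hxy h,
          fun _ _ _ h1 h2 => not_closed_spanArcs hK₀ h1 h2,
          fun _ _ _ _ _ _ _ h1 h2 h3 => absurd ⟨h1, h2, h3⟩ hval⟩
    choose F hF1 hF2 hF3 using key
    refine ⟨fun g => F (g 0).1 (g 0).2.1 (g 0).2.2.1 (g 0).2.2.2.1
      ((g 0).2.2.2.2, fun i => g i.succ), fun g => hF1 _ _ _ _ _, fun g => hF2 _ _ _ _ _, ?_⟩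
    intro S hr hS
    obtain ⟨c, o, L, p, i₀, σ, σ', hfol, h1, h2, h3⟩ := exists_guess hD hx hy hxy hK₀lt hX hr hS
    obtain ⟨⟨q, g⟩, hg⟩ := hF3 c o L p S i₀ σ σ' hr hS hfol h1 h2 h3
      ⟨fun _ => (c, o, L, p, Sum.inr (Sum.inr ()))⟩
    exact ⟨Fin.cons (c, o, L, p, q) g, by simpa using hg⟩

end Chains

section Labels
variable {V : Type}

lemma mem_deltaPlus {E : Finset (V × V)} {X : Set V} {e : V × V} :
    e ∈ deltaPlus E X ↔ e ∈ E ∧ e.1 ∈ X ∧ e.2 ∉ X := by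
  simp [deltaPlus]

/-- A lattice of vertex sets with `c` leaving arcs each, pairwise uncrossed by arcs. -/
structure CutLattice (E : Finset (V × V)) (c : ℕ) (M : Set (Set V)) : Prop where
  inter : ∀ T ∈ M, ∀ T' ∈ M, T ∩ T' ∈ M
  union : ∀ T ∈ M, ∀ T' ∈ M, T ∪ T' ∈ M
  card : ∀ T ∈ M, (deltaPlus E T).card = c
  no_cross : ∀ T ∈ M, ∀ T' ∈ M, ∀ e ∈ E, e.1 ∈ T → e.2 ∉ T → e.2 ∈ T' → e.1 ∈ T'
  nonempty : M.Nonempty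

/-- Coordinates `p` of the members of a cut lattice on `c` chains of arcs, the `n`-th arc of the
chain `j` being `(a j n, b j n)`. -/
structure Labelled (E : Finset (V × V)) (c : ℕ) (M : Set (Set V)) (a b : Fin c → ℕ → V)
    (p : Set V → Fin c → ℕ) : Prop where
  tail_mem : ∀ T ∈ M, ∀ T' ∈ M, ∀ j, a j (p T j) ∈ T' ↔ p T j ≤ p T' j
  head_mem : ∀ T ∈ M, ∀ T' ∈ M, ∀ j, b j (p T j) ∈ T' ↔ p T j < p T' j
  mem_delta : ∀ T ∈ M, ∀ e, e ∈ deltaPlus E T ↔ ∃ j, e = (a j (p T j), b j (p T j))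

variable {E : Finset (V × V)} {c : ℕ} {M : Set (Set V)}

/-- Passing to a larger set, the leaving arcs that stay keep their index. -/
lemma exists_reindex {T W : Set V} (hTW : T ⊆ W) (hW : (deltaPlus E W).card = c)
    (e : Fin c ≃ deltaPlus E T) : ∃ e' : Fin c ≃ deltaPlus E W,
      ∀ j, (e' j : V × V) = e j ∨
        ((e j : V × V).2 ∈ W \ T ∧ (e' j : V × V).1 ∈ W \ T ∧ (e j : V × V) ∉ deltaPlus E W) := by
  obtain ⟨e', he'⟩ := Finset.exists_equiv_extend_of_card_eq (α := Fin c) (β := V × V)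
    (t := deltaPlus E W) (by simp [hW])
    (s := Finset.univ.filter fun j => (e j : V × V) ∈ deltaPlus E W)
    (f := fun j => (e j : V × V)) (by intro f hf; simp at hf; grind)
    (fun i _ j _ hij => e.injective (Subtype.ext hij))
  refine ⟨e', fun j => ?_⟩
  by_cases hj : (e j : V × V) ∈ deltaPlus E W
  · exact Or.inl (he' j (by simpa using hj))
  right
  have h1 := mem_deltaPlus.1 (e j).2
  have h2 := mem_deltaPlus.1 (e' j).2
  have h3 : (e' j : V × V) ∉ deltaPlus E T := by
    intro hmem
    obtain ⟨l, hl⟩ := e.surjective ⟨e' j, hmem⟩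
    have hl' : (e l : V × V) = e' j := by rw [hl]
    have h4 := he' l (by simp [hl'])
    have : l = j := e'.injective (Subtype.ext (h4.trans hl'))
    subst this
    exact hj (hl' ▸ (e' l).2)
  refine ⟨⟨?_, h1.2.2⟩, ⟨h2.2.1, fun h => h3 (mem_deltaPlus.2 ⟨h2.1, h, fun h' => ?_⟩)⟩, hj⟩
  · by_contra h
    exact hj (mem_deltaPlus.2 ⟨h1.1, hTW h1.2.1, h⟩)
  · exact h2.2.2 (hTW h')

variable [Fintype V]

lemma CutLattice.exists_least (hM : CutLattice E c M) : ∃ T ∈ M, ∀ T' ∈ M, T ⊆ T' := by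
  obtain ⟨T, hT⟩ := (Set.toFinite M).exists_minimal hM.nonempty
  refine ⟨T, hT.prop, fun T' hT' => ?_⟩
  exact (hT.le_of_le (hM.inter T hT.prop T' hT') Set.inter_subset_left).trans
    Set.inter_subset_right

lemma CutLattice.exists_greatest (hM : CutLattice E c M) : ∃ T ∈ M, ∀ T' ∈ M, T' ⊆ T := by
  obtain ⟨T, hT⟩ := (Set.toFinite M).exists_maximal hM.nonempty
  refine ⟨T, hT.prop, fun T' hT' => ?_⟩
  exact Set.subset_union_right.trans
    (hT.le_of_ge (hM.union T hT.prop T' hT') Set.subset_union_left)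

/-- The next member of a maximal chain of `M`. -/
lemma CutLattice.exists_cover (hM : CutLattice E c M) {T top : Set V} (hT : T ∈ M)
    (htop : ∀ T' ∈ M, T' ⊆ top) (htopM : top ∈ M) : ∃ W ∈ M, T ⊆ W ∧ (T ≠ top → T ⊂ W) ∧
      ∀ T' ∈ M, ∀ u ∈ W \ T, u ∈ T' → W \ T ⊆ T' := by
  by_cases hTt : T = top
  · exact ⟨T, hT, le_rfl, fun h => absurd hTt h, fun T' _ u hu => absurd hu.1 hu.2⟩
  obtain ⟨W, hW⟩ := (Set.toFinite {W | W ∈ M ∧ T ⊂ W}).exists_minimal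
    ⟨top, htopM, (htop T hT).ssubset_of_ne hTt⟩
  obtain ⟨hWM, hTW⟩ := hW.prop
  refine ⟨W, hWM, hTW.subset, fun _ => hTW, fun T' hT' u hu huT' => ?_⟩
  have h1 : W ⊆ (T' ∩ W) ∪ T := hW.le_of_le
    ⟨hM.union _ (hM.inter _ hT' _ hWM) _ hT, Set.ssubset_iff_subset_ne.2
      ⟨Set.subset_union_right, fun h => hu.2 (h ▸ Or.inl ⟨huT', hu.1⟩)⟩⟩
    (Set.union_subset Set.inter_subset_right hTW.subset)
  intro v hv
  rcases h1 hv.1 with h | h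
  · exact h.1
  · exact absurd h hv.2

/-- A maximal chain of `M` with consistently indexed leaving arcs. -/
structure Sweep (E : Finset (V × V)) (c : ℕ) (M : Set (Set V)) (T : ℕ → Set V)
    (e : ℕ → Fin c → V × V) (m : ℕ) : Prop where
  mem : ∀ i, T i ∈ M
  mono : Monotone T
  least : ∀ T' ∈ M, T 0 ⊆ T'
  greatest : ∀ T' ∈ M, T' ⊆ T m
  leaves : ∀ i j, e i j ∈ deltaPlus E (T i)
  injective : ∀ i, Function.Injective (e i)
  step : ∀ i j, e (i + 1) j = e i j ∨
    ((e i j).2 ∈ T (i + 1) \ T i ∧ (e (i + 1) j).1 ∈ T (i + 1) \ T i ∧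
      e i j ∉ deltaPlus E (T (i + 1)))
  node : ∀ i, ∀ T' ∈ M, ∀ u ∈ T (i + 1) \ T i, u ∈ T' → T (i + 1) \ T i ⊆ T'

lemma CutLattice.exists_sweep (hM : CutLattice E c M) : ∃ T e m, Sweep E c M T e m := by
  obtain ⟨bot, hbotM, hbot⟩ := hM.exists_least
  obtain ⟨top, htopM, htop⟩ := hM.exists_greatest
  have step : ∀ x : Σ T : M, Fin c ≃ deltaPlus E (T : Set V),
      ∃ y : Σ T : M, Fin c ≃ deltaPlus E (T : Set V),
        (x.1 : Set V) ⊆ y.1 ∧ ((x.1 : Set V) ≠ top → (x.1 : Set V) ⊂ y.1) ∧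
        (∀ T' ∈ M, ∀ u ∈ (y.1 : Set V) \ x.1, u ∈ T' → (y.1 : Set V) \ x.1 ⊆ T') ∧
        ∀ j, (y.2 j : V × V) = x.2 j ∨ ((x.2 j : V × V).2 ∈ (y.1 : Set V) \ x.1 ∧
          (y.2 j : V × V).1 ∈ (y.1 : Set V) \ x.1 ∧ (x.2 j : V × V) ∉ deltaPlus E y.1) := by
    rintro ⟨⟨T, hT⟩, e⟩
    obtain ⟨W, hW, h1, h2, h3⟩ := hM.exists_cover hT htop htopM
    obtain ⟨e', he'⟩ := exists_reindex h1 (hM.card W hW) e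
    exact ⟨⟨⟨W, hW⟩, e'⟩, h1, h2, h3, he'⟩
  choose next h1 h2 h3 h4 using step
  let Y : ℕ → Σ T : M, Fin c ≃ deltaPlus E (T : Set V) := fun i => next^[i]
    ⟨⟨bot, hbotM⟩, (Finset.equivFinOfCardEq (hM.card bot hbotM)).symm⟩
  have hYs : ∀ i, Y (i + 1) = next (Y i) := fun i => Function.iterate_succ_apply' _ _ _
  have hmono : Monotone fun i => ((Y i).1 : Set V) :=
    monotone_nat_of_le_succ fun i => by simp only [hYs]; exact h1 _
  have hex : ∃ m, ((Y m).1 : Set V) = top := by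
    by_contra! hcon
    have hcard : ∀ i, i ≤ ((Y i).1 : Set V).ncard := by
      intro i
      induction i with
      | zero => exact Nat.zero_le _
      | succ i ih =>
        have := Set.ncard_lt_ncard (h2 (Y i) (hcon i)) (Set.toFinite _)
        rw [← hYs] at this
        omega
    have := (hcard (Fintype.card V + 1)).trans (Set.ncard_le_card _)
    rw [Nat.card_eq_fintype_card] at this
    omega
  obtain ⟨m, hm⟩ := hex
  refine ⟨fun i => (Y i).1, fun i j => (Y i).2 j, m, fun i => (Y i).1.2, hmono, hbot, ?_,
    fun i j => ((Y i).2 j).2, fun i => Subtype.val_injective.comp (Y i).2.injective, ?_, ?_⟩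
  · simp only [hm]
    exact htop
  · intro i j
    have := h4 (Y i) j
    rwa [← hYs] at this
  · intro i
    simp only [hYs]
    exact h3 _

lemma CutLattice.exists_labelled (hM : CutLattice E c M) : ∃ a b p, Labelled E c M a b p := by
  obtain ⟨T, e, m, hT⟩ := hM.exists_sweep
  have hback : ∀ W ∈ M, ∀ j i, (e (i + 1) j).1 ∈ W → (e i j).1 ∈ W := by
    intro W hW j i h
    rcases hT.step i j with h' | ⟨h1, h2, -⟩
    · rwa [h'] at h
    · have hl := mem_deltaPlus.1 (hT.leaves i j)
      exact hM.no_cross (T i) (hT.mem i) W hW _ hl.1 hl.2.1 hl.2.2 (hT.node i W hW _ h2 h h1)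
  have hdown : ∀ W ∈ M, ∀ j i i', i ≤ i' → (e i' j).1 ∈ W → (e i j).1 ∈ W := by
    intro W hW j i i' hi
    induction i', hi using Nat.le_induction with
    | base => exact id
    | succ i' _ ih => exact fun h => ih (hback W hW j i' h)
  let p : Set V → Fin c → ℕ := fun W j => Nat.findGreatest (fun i => (e i j).1 ∈ W) m
  have hpm : ∀ W j, p W j ≤ m := fun W j => Nat.findGreatest_le m
  have hp : ∀ W ∈ M, ∀ j i, i ≤ m → ((e i j).1 ∈ W ↔ i ≤ p W j) := by
    intro W hW j i hi
    refine ⟨fun h => Nat.le_findGreatest hi h, fun h => hdown W hW j i _ h ?_⟩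
    exact Nat.findGreatest_spec (P := fun i => (e i j).1 ∈ W) (Nat.zero_le m)
      (hT.least W hW (mem_deltaPlus.1 (hT.leaves 0 j)).2.1)
  have hhead : ∀ W ∈ M, ∀ j, (e (p W j) j).2 ∉ W := by
    intro W hW j h
    rcases (hpm W j).eq_or_lt with hm | hm
    · have := (mem_deltaPlus.1 (hT.leaves (p W j) j)).2.2
      rw [hm] at this h
      exact this (hT.greatest W hW h)
    · have hnot : (e (p W j + 1) j).1 ∉ W := by
        rw [hp W hW j _ hm]
        omega
      rcases hT.step (p W j) j with h' | ⟨h1, h2, -⟩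
      · rw [h'] at hnot
        exact hnot ((hp W hW j _ (hpm W j)).2 le_rfl)
      · exact hnot (hT.node _ W hW _ h1 h h2)
  have hleaves : ∀ W ∈ M, ∀ j, e (p W j) j ∈ deltaPlus E W := fun W hW j =>
    mem_deltaPlus.2 ⟨(mem_deltaPlus.1 (hT.leaves (p W j) j)).1,
      (hp W hW j _ (hpm W j)).2 le_rfl, hhead W hW j⟩
  have hpersist : ∀ n n' j l, n ≤ n' → e n j = e n' l → e n' j = e n' l := by
    intro n n' j l hn heq
    have h1 := mem_deltaPlus.1 (hT.leaves n j)
    have h2 := mem_deltaPlus.1 (hT.leaves n' l)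
    have : ∀ i, n ≤ i → i ≤ n' → e i j = e n j := by
      intro i hi
      induction i, hi using Nat.le_induction with
      | base => exact fun _ => rfl
      | succ i hi ih =>
        intro hi'
        have hij := ih (by omega)
        rcases hT.step i j with h | ⟨-, -, h⟩
        · rw [h, hij]
        · refine absurd ?_ h
          rw [hij, mem_deltaPlus]
          refine ⟨h1.1, hT.mono (by omega) h1.2.1, fun h' => ?_⟩
          rw [heq] at h'
          exact h2.2.2 (hT.mono hi' h')
    rw [this n' hn le_rfl, heq]
  have hinj : ∀ W, Function.Injective fun j => e (p W j) j := by
    intro W j l hjl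
    simp only at hjl
    rcases le_total (p W j) (p W l) with h | h
    · exact hT.injective _ (hpersist _ _ j l h hjl)
    · exact (hT.injective _ (hpersist _ _ l j h hjl.symm)).symm
  refine ⟨fun j i => (e i j).1, fun j i => (e i j).2, p, ?_, ?_, ?_⟩
  · intro W hW W' hW' j
    exact hp W' hW' j _ (hpm W j)
  · intro W hW W' hW' j
    have hl := mem_deltaPlus.1 (hleaves W hW j)
    refine ⟨fun h => ?_, fun h => ?_⟩
    · have h1 := (hp W' hW' j _ (hpm W j)).1 (hM.no_cross W hW W' hW' _ hl.1 hl.2.1 hl.2.2 h)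
      refine lt_of_le_of_ne h1 fun heq => hhead W' hW' j ?_
      rwa [← heq]
    · have h1 : p W j + 1 ≤ m := by have := hpm W' j; omega
      rcases hT.step (p W j) j with h' | ⟨h2, h3, -⟩
      · have : p W j + 1 ≤ p W j := (hp W hW j _ h1).1 (h' ▸ hl.2.1)
        omega
      · exact hT.node _ W' hW' _ h3 ((hp W' hW' j _ h1).2 h) h2
  · intro W hW f
    have himg : Finset.univ.image (fun j => e (p W j) j) = deltaPlus E W := by
      refine Finset.eq_of_subset_of_card_le (fun g hg => ?_) ?_
      · obtain ⟨j, -, rfl⟩ := Finset.mem_image.1 hg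
        exact hleaves W hW j
      · rw [Finset.card_image_of_injective _ (hinj W), hM.card W hW]
        simp
    rw [← himg]
    simp [eq_comm]

end Labels

section Increment
variable {V : Type}

/-- The sets separating `s` from `t` that are closed under the arcs of `A`. -/
def Sides (A : Finset (V × V)) (s t : V) : Set (Set V) :=
  {X | s ∈ X ∧ t ∉ X ∧ Closed (fun u v => (u, v) ∈ A) X}

lemma inter_mem_sides {A : Finset (V × V)} {s t : V} {X Y : Set V} (hX : X ∈ Sides A s t)
    (hY : Y ∈ Sides A s t) : X ∩ Y ∈ Sides A s t :=
  ⟨⟨hX.1, hY.1⟩, fun h => hX.2.1 h.1,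
    fun u v huv hu => ⟨hX.2.2 u v huv hu.1, hY.2.2 u v huv hu.2⟩⟩

lemma union_mem_sides {A : Finset (V × V)} {s t : V} {X Y : Set V} (hX : X ∈ Sides A s t)
    (hY : Y ∈ Sides A s t) : X ∪ Y ∈ Sides A s t :=
  ⟨Or.inl hX.1, fun h => h.elim hX.2.1 hY.2.1,
    fun u v huv hu => hu.imp (hX.2.2 u v huv) (hY.2.2 u v huv)⟩

lemma card_deltaPlus_submodular (E : Finset (V × V)) (X Y : Set V) :
    (deltaPlus E (X ∩ Y)).card + (deltaPlus E (X ∪ Y)).card +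
      (E.filter fun e => e.1 ∈ X ∧ e.1 ∉ Y ∧ e.2 ∈ Y ∧ e.2 ∉ X).card ≤
      (deltaPlus E X).card + (deltaPlus E Y).card := by
  simp only [deltaPlus, Finset.card_filter, ← Finset.sum_add_distrib]
  refine Finset.sum_le_sum fun e _ => ?_
  by_cases h1 : e.1 ∈ X <;> by_cases h2 : e.1 ∈ Y <;> by_cases h3 : e.2 ∈ X <;>
    by_cases h4 : e.2 ∈ Y <;> simp [h1, h2, h3, h4]

/-- The sets of `Sides A s t` with exactly `c` leaving arcs. -/
def MinSides (E A : Finset (V × V)) (s t : V) (c : ℕ) : Set (Set V) :=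
  {X | X ∈ Sides A s t ∧ (deltaPlus E X).card = c}

lemma cutLattice_minSides {E A : Finset (V × V)} {s t : V} {c : ℕ}
    (hc : ∀ X ∈ Sides A s t, c ≤ (deltaPlus E X).card) (hne : (MinSides E A s t c).Nonempty) :
    CutLattice E c (MinSides E A s t c) where
  inter := fun T hT T' hT' => by
    have h1 := card_deltaPlus_submodular E T T'
    have h2 := hc _ (inter_mem_sides hT.1 hT'.1)
    have h3 := hc _ (union_mem_sides hT.1 hT'.1)
    have h4 := hT.2
    have h5 := hT'.2
    exact ⟨inter_mem_sides hT.1 hT'.1, by omega⟩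
  union := fun T hT T' hT' => by
    have h1 := card_deltaPlus_submodular E T T'
    have h2 := hc _ (inter_mem_sides hT.1 hT'.1)
    have h3 := hc _ (union_mem_sides hT.1 hT'.1)
    have h4 := hT.2
    have h5 := hT'.2
    exact ⟨union_mem_sides hT.1 hT'.1, by omega⟩
  card := fun T hT => hT.2
  no_cross := fun T hT T' hT' e he h1 h2 h3 => by
    by_contra h4
    have h5 := card_deltaPlus_submodular E T T'
    have h6 := hc _ (inter_mem_sides hT.1 hT'.1)
    have h7 := hc _ (union_mem_sides hT.1 hT'.1)
    have h8 := hT.2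
    have h9 := hT'.2
    have h10 : 0 < (E.filter fun e => e.1 ∈ T ∧ e.1 ∉ T' ∧ e.2 ∈ T' ∧ e.2 ∉ T).card :=
      Finset.card_pos.2 ⟨e, by simp [he, h1, h2, h3, h4]⟩
    omega
  nonempty := hne

namespace Labelled

variable {E : Finset (V × V)} {c : ℕ} {M : Set (Set V)} {a b : Fin c → ℕ → V}
  {p : Set V → Fin c → ℕ}

lemma mono (h : Labelled E c M a b p) {T T' : Set V} (hT : T ∈ M) (hT' : T' ∈ M)
    (hTT' : T ⊆ T') : p T ≤ p T' := fun j =>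
  (h.tail_mem T hT T' hT' j).1 (hTT' ((h.tail_mem T hT T hT j).2 le_rfl))

lemma map_inter (h : Labelled E c M a b p) (hM : CutLattice E c M) {T T' : Set V} (hT : T ∈ M)
    (hT' : T' ∈ M) : p (T ∩ T') = p T ⊓ p T' := by
  have hW := hM.inter T hT T' hT'
  refine le_antisymm (le_inf (h.mono hW hT Set.inter_subset_left)
    (h.mono hW hT' Set.inter_subset_right)) fun j => ?_
  rw [Pi.inf_apply]
  rcases le_total (p T j) (p T' j) with hle | hle
  · rw [inf_eq_left.2 hle]
    exact (h.tail_mem T hT _ hW j).1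
      ⟨(h.tail_mem T hT T hT j).2 le_rfl, (h.tail_mem T hT T' hT' j).2 hle⟩
  · rw [inf_eq_right.2 hle]
    exact (h.tail_mem T' hT' _ hW j).1
      ⟨(h.tail_mem T' hT' T hT j).2 hle, (h.tail_mem T' hT' T' hT' j).2 le_rfl⟩

lemma map_union (h : Labelled E c M a b p) (hM : CutLattice E c M) {T T' : Set V} (hT : T ∈ M)
    (hT' : T' ∈ M) : p (T ∪ T') = p T ⊔ p T' := by
  have hW := hM.union T hT T' hT'
  refine le_antisymm (fun j => ?_) (sup_le (h.mono hT hW Set.subset_union_left)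
    (h.mono hT' hW Set.subset_union_right))
  rcases (h.tail_mem _ hW _ hW j).2 le_rfl with hj | hj
  · exact ((h.tail_mem _ hW T hT j).1 hj).trans le_sup_left
  · exact ((h.tail_mem _ hW T' hT' j).1 hj).trans le_sup_right

/-- The arc of the chain `j` leaving `T`. -/
lemma mem_delta_self (h : Labelled E c M a b p) {T : Set V} (hT : T ∈ M) (j : Fin c) :
    (a j (p T j), b j (p T j)) ∈ deltaPlus E T :=
  (h.mem_delta T hT _).2 ⟨j, rfl⟩

end Labelled

/-- The vertex at a port. -/
def vertexAt {c : ℕ} (a b : Fin c → ℕ → V) : Port (Fin c) → V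
  | Port.tail j n => a j n
  | Port.head j n => b j n

/-- The arcs leaving `S` form a cut each of whose arcs can be reached from `s` inside `S` and
reaches `t` outside `S`. -/
structure Tight (E : Finset (V × V)) (s t : V) (S : Set V) : Prop where
  source_mem : s ∈ S
  sink_notMem : t ∉ S
  forward : ∀ e ∈ deltaPlus E S, ∀ T : Set V, t ∉ T → e.2 ∈ T → ∃ f ∈ deltaPlus E T, f.1 ∉ S
  backward : ∀ e ∈ deltaPlus E S, ∀ T : Set V, s ∈ T → e.1 ∉ T → ∃ f ∈ deltaPlus E T, f.2 ∈ S

lemma Tight.delta_subset {E : Finset (V × V)} {s t : V} {S : Set V} (hS : Tight E s t S)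
    {T : Set V} (hs : s ∈ T) (ht : t ∉ T) (hTS : deltaPlus E T ⊆ deltaPlus E S) :
    deltaPlus E S ⊆ deltaPlus E T := by
  intro e he
  rw [mem_deltaPlus]
  refine ⟨(mem_deltaPlus.1 he).1, ?_, fun h => ?_⟩
  · by_contra h
    obtain ⟨f, hf, hfS⟩ := hS.backward e he T hs h
    exact (mem_deltaPlus.1 (hTS hf)).2.2 hfS
  · obtain ⟨f, hf, hfS⟩ := hS.forward e he T ht h
    exact hfS (mem_deltaPlus.1 (hTS hf)).2.1

/-- Summing submodularity along a chain of minimum sides. -/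
lemma sum_card_delta_le {E : Finset (V × V)} {c : ℕ} {S : Set V} (R : ℕ → Set V) (hR : Monotone R)
    (hcard : ∀ h, (deltaPlus E (R h)).card = c) (n : ℕ) :
    ∑ h ∈ Finset.range n, (deltaPlus E ((S ∪ R h) ∩ R (h + 1))).card +
      (deltaPlus E (S ∪ R n)).card ≤ (deltaPlus E (S ∪ R 0)).card + n * c := by
  induction n with
  | zero => simp
  | succ n ih =>
    have h1 := card_deltaPlus_submodular E (S ∪ R n) (R (n + 1))
    have h2 : R n ⊆ R (n + 1) := hR (Nat.le_succ n)
    rw [Set.union_assoc, Set.union_eq_self_of_subset_left h2, hcard] at h1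
    rw [Finset.sum_range_succ, Nat.succ_mul]
    omega

variable [Fintype V]

/-- The coordinates of the members of `M`. -/
noncomputable def coords {c : ℕ} (M : Set (Set V)) (p : Set V → Fin c → ℕ) :
    Finset (Fin c → ℕ) :=
  (Set.toFinite M).toFinset.image p

lemma mem_coords {c : ℕ} {M : Set (Set V)} {p : Set V → Fin c → ℕ} {x : Fin c → ℕ} :
    x ∈ coords M p ↔ ∃ T ∈ M, p T = x := by
  simp [coords]

variable {E : Finset (V × V)} {c : ℕ} {M : Set (Set V)} {a b : Fin c → ℕ → V}
  {p : Set V → Fin c → ℕ}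

lemma Labelled.isLat (h : Labelled E c M a b p) (hM : CutLattice E c M) : IsLat (coords M p) where
  sup := fun x hx y hy => by
    obtain ⟨T, hT, rfl⟩ := mem_coords.1 hx
    obtain ⟨T', hT', rfl⟩ := mem_coords.1 hy
    exact mem_coords.2 ⟨_, hM.union T hT T' hT', h.map_union hM hT hT'⟩
  inf := fun x hx y hy => by
    obtain ⟨T, hT, rfl⟩ := mem_coords.1 hx
    obtain ⟨T', hT', rfl⟩ := mem_coords.1 hy
    exact mem_coords.2 ⟨_, hM.inter T hT T' hT', h.map_inter hM hT hT'⟩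

lemma Labelled.vertexAt_mem_iff (h : Labelled E c M a b p) {x y : Fin c → ℕ}
    {K : Finset (Fin c)} {v : Port (Fin c)} (hv : v ∈ ports (coords M p) x y K) {T : Set V}
    (hT : T ∈ M) : vertexAt a b v ∈ T ↔ v ∈ below (p T) := by
  obtain ⟨j, -, z, hz, -, -, rfl | rfl⟩ := hv <;> obtain ⟨W, hW, rfl⟩ := mem_coords.1 hz
  · exact h.tail_mem W hW T hT j
  · exact h.head_mem W hW T hT j

/-- Monotone representatives of coordinates. -/
lemma Labelled.exists_rep (h : Labelled E c M a b p) (hM : CutLattice E c M) :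
    ∃ R : (Fin c → ℕ) → Set V, Monotone R ∧ ∀ x ∈ coords M p, R x ∈ M ∧ p (R x) = x := by
  refine ⟨fun x => ⋃₀ {T | T ∈ M ∧ p T ≤ x}, fun x y hxy =>
    Set.sUnion_subset_sUnion fun T hT => ⟨hT.1, hT.2.trans hxy⟩, fun x hx => ?_⟩
  obtain ⟨T, hT, rfl⟩ := mem_coords.1 hx
  obtain ⟨G, hG⟩ := (Set.toFinite {W | W ∈ M ∧ p W ≤ p T}).exists_maximal ⟨T, hT, le_rfl⟩
  have hsub : ∀ W, W ∈ M ∧ p W ≤ p T → W ⊆ G := fun W hW =>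
    Set.subset_union_right.trans (hG.le_of_ge ⟨hM.union G hG.prop.1 W hW.1, by
      rw [h.map_union hM hG.prop.1 hW.1]
      exact sup_le hG.prop.2 hW.2⟩ Set.subset_union_left)
  have heq : ⋃₀ {W | W ∈ M ∧ p W ≤ p T} = G :=
    subset_antisymm (Set.sUnion_subset hsub) (Set.subset_sUnion_of_mem hG.prop)
  simp only [heq]
  exact ⟨hG.prop.1, le_antisymm hG.prop.2 (h.mono hT hG.prop.1 (hsub T ⟨hT, le_rfl⟩))⟩

section

variable {A : Finset (V × V)} {s t : V} {S : Set V}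

lemma Labelled.admissible (h : Labelled E c (MinSides E A s t c) a b p)
    (hc : ∀ X ∈ Sides A s t, c ≤ (deltaPlus E X).card) (hS : Tight E s t S)
    (hSA : S ∈ Sides A s t) (hcS : c < (deltaPlus E S).card) {x y : Fin c → ℕ}
    (hx : ∀ j, a j (x j) ∈ S) (hy : ∀ j, b j (y j) ∉ S) :
    Admissible (coords (MinSides E A s t c) p) (vertexAt a b ⁻¹' S) x y Finset.univ := by
  refine ⟨fun j _ => hx j, fun j _ => hy j, fun z hz _ _ htr => ?_, fun z hz _ _ htail => ?_,
    fun z hz _ _ hhead => ?_⟩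
  · obtain ⟨T, hT, rfl⟩ := mem_coords.1 hz
    have hTS : deltaPlus E T ⊆ deltaPlus E S := fun e he => by
      obtain ⟨j, rfl⟩ := (h.mem_delta T hT e).1 he
      have := htr j (Finset.mem_univ j)
      exact mem_deltaPlus.2 ⟨(mem_deltaPlus.1 he).1, this.1, this.2⟩
    have := Finset.card_le_card (hS.delta_subset hT.1.1 hT.1.2.1 hTS)
    have := hT.2
    omega
  · obtain ⟨T, hT, rfl⟩ := mem_coords.1 hz
    have hsub : deltaPlus E (T ∩ S) ⊆ deltaPlus E T := fun e he => by
      obtain ⟨h1, h2, h3⟩ := mem_deltaPlus.1 he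
      refine mem_deltaPlus.2 ⟨h1, h2.1, fun h4 => ?_⟩
      have heS : e ∈ deltaPlus E S := mem_deltaPlus.2 ⟨h1, h2.2, fun h5 => h3 ⟨h4, h5⟩⟩
      obtain ⟨f, hf, hfS⟩ := hS.forward e heS T hT.1.2.1 h4
      obtain ⟨j, rfl⟩ := (h.mem_delta T hT f).1 hf
      exact hfS (htail j (Finset.mem_univ j))
    have hside := inter_mem_sides hT.1 hSA
    have heq := Finset.eq_of_subset_of_card_le hsub (hT.2.le.trans (hc _ hside))
    have hTS : T ∩ S ∈ MinSides E A s t c := ⟨hside, by rw [heq, hT.2]⟩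
    have hpe : p (T ∩ S) = p T := le_antisymm (h.mono hTS hT Set.inter_subset_left) fun j => by
      have := h.mem_delta_self hT j
      rw [← heq, mem_deltaPlus] at this
      exact (h.tail_mem T hT _ hTS j).1 this.2.1
    intro w hw _ _ j _
    obtain ⟨W, hW, rfl⟩ := mem_coords.1 hw
    rw [← hpe]
    exact ⟨fun h1 => ((h.tail_mem W hW _ hTS j).2 h1).2,
      fun h1 => ((h.head_mem W hW _ hTS j).2 h1).2⟩
  · obtain ⟨T, hT, rfl⟩ := mem_coords.1 hz
    have hsub : deltaPlus E (T ∪ S) ⊆ deltaPlus E T := fun e he => by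
      obtain ⟨h1, h2, h3⟩ := mem_deltaPlus.1 he
      refine mem_deltaPlus.2 ⟨h1, ?_, fun h4 => h3 (Or.inl h4)⟩
      by_contra h4
      have heS : e ∈ deltaPlus E S :=
        mem_deltaPlus.2 ⟨h1, h2.resolve_left h4, fun h5 => h3 (Or.inr h5)⟩
      obtain ⟨f, hf, hfS⟩ := hS.backward e heS T hT.1.1 h4
      obtain ⟨j, rfl⟩ := (h.mem_delta T hT f).1 hf
      exact hhead j (Finset.mem_univ j) hfS
    have hside := union_mem_sides hT.1 hSA
    have heq := Finset.eq_of_subset_of_card_le hsub (hT.2.le.trans (hc _ hside))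
    have hTS : T ∪ S ∈ MinSides E A s t c := ⟨hside, by rw [heq, hT.2]⟩
    have hpe : p (T ∪ S) = p T := le_antisymm (fun j => by
      have := h.mem_delta_self hT j
      rw [← heq, mem_deltaPlus] at this
      exact not_lt.1 fun hlt => this.2.2 ((h.head_mem T hT _ hTS j).2 hlt))
      (h.mono hT hTS Set.subset_union_left)
    intro w hw _ _ j _
    obtain ⟨W, hW, rfl⟩ := mem_coords.1 hw
    rw [← hpe]
    exact ⟨fun h1 h2 => absurd ((h.head_mem W hW _ hTS j).1 (Or.inr h2)) (not_lt.2 h1),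
      fun h1 h2 => absurd ((h.tail_mem W hW _ hTS j).1 (Or.inr h2)) (not_le.2 h1)⟩

lemma Labelled.fewUnclean (h : Labelled E c (MinSides E A s t c) a b p)
    (hc : ∀ X ∈ Sides A s t, c ≤ (deltaPlus E X).card)
    (hM : CutLattice E c (MinSides E A s t c)) (hSA : S ∈ Sides A s t) {k : ℕ}
    (hk : (deltaPlus E S).card ≤ k) :
    FewUnclean (2 * k) (coords (MinSides E A s t c) p) (vertexAt a b ⁻¹' S) := by
  intro X hX hXD B hB
  obtain ⟨rep, hrep, hrepM⟩ := h.exists_rep hM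
  set R : ℕ → Set V := fun i => rep (X i) with hRdef
  have hR : Monotone R := hrep.comp hX
  have hRM : ∀ i, R i ∈ MinSides E A s t c := fun i => (hrepM _ (hXD i)).1
  have hRp : ∀ i, p (R i) = X i := fun i => (hrepM _ (hXD i)).2
  let T : ℕ → Set V := fun i => (S ∪ R i) ∩ R (i + 1)
  have hTside : ∀ i, T i ∈ Sides A s t := fun i =>
    inter_mem_sides (union_mem_sides hSA (hRM i).1) (hRM (i + 1)).1
  have hcross : ∀ i ∈ B, (deltaPlus E (T i)).card = c →
      ∃ e ∈ deltaPlus E S, e.2 ∈ R (i + 1) ∧ e.2 ∉ R i := by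
    intro i hi hTc
    by_contra! hno
    have hTM : T i ∈ MinSides E A s t c := ⟨hTside i, hTc⟩
    have hRT : R i ⊆ T i := fun v hv => ⟨Or.inr hv, hR (Nat.le_succ i) hv⟩
    have hle := h.mono (hRM i) hTM hRT
    have hle' := h.mono hTM (hRM (i + 1)) Set.inter_subset_right
    rw [hRp] at hle hle'
    refine hB i hi ⟨p (T i), mem_coords.2 ⟨_, hTM, rfl⟩, hle, hle', fun j hj => ?_⟩
    obtain ⟨he, h1, h2⟩ := mem_deltaPlus.1 (h.mem_delta_self hTM j)
    have h3 : a j (p (T i) j) ∈ R i ↔ p (T i) j ≤ X i j := by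
      rw [h.tail_mem _ hTM _ (hRM i) j, hRp]
    have h4 : b j (p (T i) j) ∈ R (i + 1) ↔ p (T i) j < X (i + 1) j := by
      rw [h.head_mem _ hTM _ (hRM _) j, hRp]
    rcases (hle' j).eq_or_lt with heq | hlt
    · left
      refine ⟨heq, ?_⟩
      rw [Set.mem_preimage, ← heq]
      refine h1.1.resolve_right fun h5 => ?_
      have h6 : p (T i) j ≤ X i j := h3.1 h5
      have h7 : p (T i) j = X (i + 1) j := heq
      have h8 : X i j < X (i + 1) j := hj
      omega
    · right
      have h5 := h4.2 hlt
      have h6 : b j (p (T i) j) ∉ S := fun h6 => h2 ⟨Or.inl h6, h5⟩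
      have h7 : b j (p (T i) j) ∉ R i := fun h7 => h2 ⟨Or.inr h7, h5⟩
      have heq : p (T i) j = X i j := by
        by_contra hne
        have h8 : a j (p (T i) j) ∈ S := h1.1.resolve_right fun h9 =>
          hne (le_antisymm (h3.1 h9) (hle j))
        exact h7 (hno _ (mem_deltaPlus.2 ⟨he, h8, h6⟩) h5)
      refine ⟨heq, ?_⟩
      rw [Set.mem_preimage, ← heq]
      exact h6
  have hsmall : (B.filter fun i => (deltaPlus E (T i)).card = c).card ≤ k := by
    have : ∀ i, ∃ e, i ∈ B.filter (fun i => (deltaPlus E (T i)).card = c) →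
        e ∈ deltaPlus E S ∧ e.2 ∈ R (i + 1) ∧ e.2 ∉ R i := by
      intro i
      by_cases hi : i ∈ B.filter (fun i => (deltaPlus E (T i)).card = c)
      · obtain ⟨hiB, hic⟩ := Finset.mem_filter.1 hi
        obtain ⟨e, he⟩ := hcross i hiB hic
        exact ⟨e, fun _ => he⟩
      · exact ⟨(s, s), fun h => absurd h hi⟩
    choose e he using this
    refine (Finset.card_le_card_of_injOn e (fun i hi => (he i hi).1) ?_).trans hk
    intro i hi i' hi' heq
    have h1 := (he i hi).2
    have h2 := (he i' hi').2
    rw [heq] at h1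
    rcases lt_trichotomy i i' with hlt | rfl | hlt
    · exact absurd (hR (Nat.succ_le_of_lt hlt) h1.1) h2.2
    · rfl
    · exact absurd (hR (Nat.succ_le_of_lt hlt) h2.1) h1.2
  have hlarge : (B.filter fun i => ¬ (deltaPlus E (T i)).card = c).card ≤ k := by
    obtain ⟨n, hn⟩ : ∃ n, B ⊆ Finset.range n := B.exists_nat_subset_range
    have h1 := sum_card_delta_le (E := E) (S := S) R hR (fun i => (hRM i).2) n
    have h2 := hc _ (union_mem_sides hSA (hRM n).1)
    have h3 := card_deltaPlus_submodular E S (R 0)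
    have h4 := hc _ (inter_mem_sides hSA (hRM 0).1)
    have h5 := (hRM 0).2
    have h6 : n * c + (B.filter fun i => ¬ (deltaPlus E (T i)).card = c).card ≤
        ∑ i ∈ Finset.range n, (deltaPlus E (T i)).card := by
      have h7 : (B.filter fun i => ¬ (deltaPlus E (T i)).card = c).card ≤
          ∑ i ∈ Finset.range n, if (deltaPlus E (T i)).card = c then 0 else 1 := by
        rw [Finset.card_filter]
        refine (Finset.sum_le_sum_of_subset hn).trans (Finset.sum_le_sum fun i _ => ?_)
        split_ifs <;> simp_all
      have h8 : n * c = ∑ i ∈ Finset.range n, c := by simp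
      rw [h8]
      refine (Nat.add_le_add_left h7 _).trans ?_
      rw [← Finset.sum_add_distrib]
      refine Finset.sum_le_sum fun i _ => ?_
      have := hc _ (hTside i)
      split_ifs <;> omega
    simp only [T] at h6 ⊢
    omega
  have := Finset.card_filter_add_card_filter_not (s := B) (fun i => (deltaPlus E (T i)).card = c)
  omega

end

end Increment

section Rounds
variable {V : Type}

lemma sides_union {A B : Finset (V × V)} {s t : V} {X : Set V} :
    X ∈ Sides (A ∪ B) s t ↔ X ∈ Sides A s t ∧ Closed (fun u v => (u, v) ∈ B) X := by
  refine ⟨fun h => ⟨⟨h.1, h.2.1, fun u v huv => h.2.2 u v (Finset.mem_union_left _ huv)⟩,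
    fun u v huv => h.2.2 u v (Finset.mem_union_right _ huv)⟩,
    fun h => ⟨h.1.1, h.1.2.1, fun u v huv => ?_⟩⟩
  exact (Finset.mem_union.1 huv).elim (h.1.2.2 u v) (h.2 u v)

variable [Fintype V]

/-- Sets of arcs that destroy all minimum sides of size `c`, one of which spares `S`. -/
lemma exists_increment {E A : Finset (V × V)} {s t : V} {c k : ℕ} (hc0 : 0 < c)
    (hc : ∀ X ∈ Sides A s t, c ≤ (deltaPlus E X).card) (hne : (MinSides E A s t c).Nonempty) :
    ∃ 𝓑 : Finset (Finset (V × V)),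
      𝓑.card ≤ 2 * c + Fintype.card (Guess (Fin c) (2 * k)) ^ (c * c) ∧
      (∀ B ∈ 𝓑, ∀ X ∈ MinSides E A s t c, ¬ Closed (fun u v => (u, v) ∈ B) X) ∧
      ∀ S, Tight E s t S → S ∈ Sides A s t → (deltaPlus E S).card ≤ k →
        c < (deltaPlus E S).card → ∃ B ∈ 𝓑, Closed (fun u v => (u, v) ∈ B) S := by
  have hM := cutLattice_minSides hc hne
  obtain ⟨a, b, p, h⟩ := hM.exists_labelled
  obtain ⟨bot, hbotM, hbot⟩ := hM.exists_least
  obtain ⟨top, htopM, htop⟩ := hM.exists_greatest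
  have : Nonempty (Fin c) := ⟨⟨0, hc0⟩⟩
  obtain ⟨F, hF⟩ := exists_separating (h.isLat hM) (2 * k) (c * c) (p bot)
    (mem_coords.2 ⟨bot, hbotM, rfl⟩) (p top) (mem_coords.2 ⟨top, htopM, rfl⟩)
    (h.mono hbotM htopM (hbot top htopM)) Finset.univ Finset.univ_nonempty
    (fun j hj => absurd (Finset.mem_univ j) hj)
    ((Finset.card_le_univ _).trans (by simp))
  let f : (Fin c ⊕ Fin c) ⊕ (Fin (c * c) → Guess (Fin c) (2 * k)) → Finset (V × V) :=
    Sum.elim (Sum.elim (fun j => {(a j (p bot j), t)}) fun j => {(s, b j (p top j))})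
      fun g => Finset.univ.filter fun e =>
        ∃ u v, F g u v ∧ e = (vertexAt a b u, vertexAt a b v)
  refine ⟨Finset.univ.image f, ?_, ?_, ?_⟩
  · refine Finset.card_image_le.trans (le_of_eq ?_)
    simp only [Finset.card_univ, Fintype.card_sum, Fintype.card_fin, Fintype.card_fun]
    ring
  · intro B hB X hX hcl
    obtain ⟨i, -, rfl⟩ := Finset.mem_image.1 hB
    rcases i with (j | j) | g
    · refine hX.1.2.1 (hcl (a j (p bot j)) t (by simp [f]) (hbot X hX ?_))
      exact (h.tail_mem bot hbotM bot hbotM j).2 le_rfl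
    · have h1 := htop X hX (hcl s (b j (p top j)) (by simp [f]) hX.1.1)
      exact lt_irrefl _ ((h.head_mem top htopM top htopM j).1 h1)
    · refine hF.not_closed g (p X) (mem_coords.2 ⟨X, hX, rfl⟩) (h.mono hbotM hX (hbot X hX))
        (h.mono hX htopM (htop X hX)) fun u v huv hu => ?_
      obtain ⟨hup, hvp⟩ := hF.mem_ports g u v huv
      rw [← h.vertexAt_mem_iff hup hX] at hu
      rw [← h.vertexAt_mem_iff hvp hX]
      exact hcl _ _ (by simpa [f] using ⟨u, v, huv, rfl, rfl⟩) hu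
  · intro S hS hSA hSk hcS
    by_cases h1 : ∃ j, a j (p bot j) ∉ S
    · obtain ⟨j, hj⟩ := h1
      refine ⟨f (Sum.inl (Sum.inl j)), Finset.mem_image_of_mem _ (Finset.mem_univ _), ?_⟩
      intro u v huv hu
      simp only [f, Sum.elim_inl, Finset.mem_singleton, Prod.mk.injEq] at huv
      exact absurd (huv.1 ▸ hu) hj
    by_cases h2 : ∃ j, b j (p top j) ∈ S
    · obtain ⟨j, hj⟩ := h2
      refine ⟨f (Sum.inl (Sum.inr j)), Finset.mem_image_of_mem _ (Finset.mem_univ _), ?_⟩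
      intro u v huv hu
      simp only [f, Sum.elim_inl, Sum.elim_inr, Finset.mem_singleton, Prod.mk.injEq] at huv
      exact huv.2 ▸ hj
    push Not at h1 h2
    obtain ⟨g, hg⟩ := hF.exists_closed (vertexAt a b ⁻¹' S) (h.fewUnclean hc hM hSA hSk)
      (h.admissible hc hS hSA hcS h1 h2)
    refine ⟨f (Sum.inr g), Finset.mem_image_of_mem _ (Finset.mem_univ _), fun u v huv hu => ?_⟩
    simp only [f, Sum.elim_inr, Finset.mem_filter, Finset.mem_univ, true_and,
      Prod.mk.injEq] at huv
    obtain ⟨u', v', huv', rfl, rfl⟩ := huv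
    exact hg u' v' huv' hu

lemma exists_augmenting_round (E : Finset (V × V)) (s t : V) {k c N : ℕ}
    (hN : 2 * c + Fintype.card (Guess (Fin c) (2 * k)) ^ (c * c) ≤ N) (A : Finset (V × V)) :
    ∃ 𝓐 : Finset (Finset (V × V)), 𝓐.card ≤ N + 1 ∧
      ∀ S, Tight E s t S → (deltaPlus E S).card ≤ k → S ∈ Sides A s t →
        (∀ X ∈ Sides A s t, min c (deltaPlus E S).card ≤ (deltaPlus E X).card) →
        ∃ A' ∈ 𝓐, S ∈ Sides A' s t ∧
          ∀ X ∈ Sides A' s t, min (c + 1) (deltaPlus E S).card ≤ (deltaPlus E X).card := by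
  have hkeep : ∀ S, Tight E s t S → S ∈ Sides A s t →
      (∀ X ∈ Sides A s t, min c (deltaPlus E S).card ≤ (deltaPlus E X).card) →
      ((MinSides E A s t c).Nonempty → 0 < c → (deltaPlus E S).card ≤ c) →
      ∀ X ∈ Sides A s t, min (c + 1) (deltaPlus E S).card ≤ (deltaPlus E X).card := by
    intro S hS hSA hmin hor X hX
    have h1 := hmin X hX
    by_contra hlt
    have hXc : (deltaPlus E X).card = c := by omega
    rcases Nat.eq_zero_or_pos c with rfl | hc0
    · have h2 := hS.delta_subset hX.1 hX.2.1 (by simp [Finset.card_eq_zero.1 hXc])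
      have := Finset.card_le_card h2
      omega
    · have := hor ⟨X, hX, hXc⟩ hc0
      omega
  by_cases hcase : (∀ X ∈ Sides A s t, c ≤ (deltaPlus E X).card) ∧
      (MinSides E A s t c).Nonempty ∧ 0 < c
  · obtain ⟨hc, hne, hc0⟩ := hcase
    obtain ⟨𝓑, hcard, hkill, hspare⟩ := exists_increment (k := k) hc0 hc hne
    refine ⟨insert A (𝓑.image (A ∪ ·)), (Finset.card_insert_le _ _).trans
      (Nat.succ_le_succ (Finset.card_image_le.trans (hcard.trans hN))), ?_⟩
    intro S hS hSk hSA hmin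
    by_cases hcS : c < (deltaPlus E S).card
    · obtain ⟨B, hB, hBS⟩ := hspare S hS hSA hSk hcS
      refine ⟨A ∪ B, Finset.mem_insert_of_mem (Finset.mem_image_of_mem _ hB),
        sides_union.2 ⟨hSA, hBS⟩, fun X hX => ?_⟩
      obtain ⟨hXA, hXB⟩ := sides_union.1 hX
      have h1 := hc X hXA
      have h2 : (deltaPlus E X).card ≠ c := fun h => hkill B hB X ⟨hXA, h⟩ hXB
      omega
    · exact ⟨A, Finset.mem_insert_self _ _, hSA,
        hkeep S hS hSA hmin fun _ _ => not_lt.1 hcS⟩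
  · refine ⟨{A}, by simp, fun S hS _ hSA hmin => ⟨A, Finset.mem_singleton_self A, hSA,
      hkeep S hS hSA hmin fun hne hc0 => ?_⟩⟩
    by_contra hlt
    refine hcase ⟨fun X hX => ?_, hne, hc0⟩
    have := hmin X hX
    omega

lemma exists_augmenting_rounds (E : Finset (V × V)) (s t : V) {k N : ℕ}
    (hN : ∀ c ≤ k, 2 * c + Fintype.card (Guess (Fin c) (2 * k)) ^ (c * c) ≤ N) (r : ℕ)
    (hr : r ≤ k + 1) :
    ∃ 𝓐 : Finset (Finset (V × V)), 𝓐.card ≤ (N + 1) ^ r ∧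
      ∀ S, Tight E s t S → (deltaPlus E S).card ≤ k → ∃ A ∈ 𝓐, S ∈ Sides A s t ∧
        ∀ X ∈ Sides A s t, min r (deltaPlus E S).card ≤ (deltaPlus E X).card := by
  induction r with
  | zero =>
    refine ⟨{∅}, by simp, fun S hS _ => ⟨∅, Finset.mem_singleton_self _,
      ⟨hS.source_mem, hS.sink_notMem, fun u v huv => by simp at huv⟩, by simp⟩⟩
  | succ r ih =>
    obtain ⟨𝓐, hcard, hA⟩ := ih (by omega)
    choose 𝓕 hFcard hF using exists_augmenting_round E s t (hN r (by omega))
    refine ⟨𝓐.biUnion 𝓕, ?_, fun S hS hSk => ?_⟩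
    · rw [pow_succ]
      exact (Finset.card_biUnion_le_card_mul _ _ _ fun A _ => hFcard A).trans
        (Nat.mul_le_mul_right _ hcard)
    · obtain ⟨A, hAm, hSA, hmin⟩ := hA S hS hSk
      obtain ⟨A', hA', h1⟩ := hF A S hS hSk hSA hmin
      exact ⟨A', Finset.mem_biUnion.2 ⟨A, hAm, hA'⟩, h1⟩

end Rounds

section MinimalCuts
variable {V : Type} {E Z : Finset (V × V)} {s t : V}

/-- A path that leaves `T` does so along an arc. -/
lemma Reach.exists_leaving {A : Set (V × V)} {u v : V} (h : Reach A u v) {T : Set V} (hu : u ∈ T)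
    (hv : v ∉ T) : ∃ x y, Reach A u x ∧ Reach A y v ∧ (x, y) ∈ A ∧ x ∈ T ∧ y ∉ T := by
  induction h using Relation.ReflTransGen.head_induction_on with
  | refl => exact absurd hu hv
  | head hxy hyv ih =>
    rename_i x y
    by_cases hy : y ∈ T
    · obtain ⟨x', y', h1, h2⟩ := ih hy
      exact ⟨x', y', h1.head hxy, h2⟩
    · exact ⟨x, y, Relation.ReflTransGen.refl, hyv, hxy, hu, hy⟩

lemma IsCut.deltaPlus_sSide_subset : deltaPlus E (sSide E s Z) ⊆ Z := by
  intro e he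
  obtain ⟨h1, h2, h3⟩ := mem_deltaPlus.1 he
  by_contra h4
  exact h3 (Relation.ReflTransGen.tail h2 ⟨h1, h4⟩)

lemma isCut_deltaPlus {X : Set V} (hs : s ∈ X) (ht : t ∉ X) : IsCut E s t (deltaPlus E X) := by
  refine ⟨Finset.filter_subset _ _, fun h => ?_⟩
  obtain ⟨x, y, -, -, hxy, hx, hy⟩ := h.exists_leaving hs ht
  exact hxy.2 (mem_deltaPlus.2 ⟨hxy.1, hx, hy⟩)

lemma IsMinimalCut.deltaPlus_sSide (hZ : IsMinimalCut E s t Z) :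
    deltaPlus E (sSide E s Z) = Z := by
  by_contra hne
  exact hZ.2 _ (IsCut.deltaPlus_sSide_subset.ssubset_of_ne hne)
    (isCut_deltaPlus Relation.ReflTransGen.refl hZ.1.2)

lemma IsMinimalCut.tight (hZ : IsMinimalCut E s t Z) : Tight E s t (sSide E s Z) where
  source_mem := Relation.ReflTransGen.refl
  sink_notMem := hZ.1.2
  forward := fun e he T htT heT => by
    have hd := hZ.deltaPlus_sSide
    have heZ : e ∈ Z := hd ▸ he
    have hcut : ¬ IsCut E s t (Z.erase e) := hZ.2 _ (Finset.erase_ssubset heZ)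
    have hreach : Reach ((E : Set (V × V)) \ (Z : Set (V × V))) e.2 t := by
      by_contra hno
      refine hcut ⟨(Finset.erase_subset _ _).trans hZ.1.1, fun h => ?_⟩
      obtain ⟨x, y, -, -, hxy, hx, hy⟩ := h.exists_leaving
        (T := sSide E s Z ∪ {v | Reach ((E : Set (V × V)) \ (Z : Set (V × V))) e.2 v})
        (Or.inl Relation.ReflTransGen.refl) (fun h => h.elim hZ.1.2 hno)
      by_cases hxe : (x, y) = e
      · subst hxe
        exact hy (Or.inr Relation.ReflTransGen.refl)
      · have hxyZ : (x, y) ∈ (E : Set (V × V)) \ (Z : Set (V × V)) :=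
          ⟨hxy.1, fun h => hxy.2 (Finset.mem_coe.2 (Finset.mem_erase.2 ⟨hxe, h⟩))⟩
        exact hy (hx.imp (fun h => Relation.ReflTransGen.tail h hxyZ)
          fun h => Relation.ReflTransGen.tail h hxyZ)
    obtain ⟨x, y, -, h2, hxy, hx, hy⟩ := hreach.exists_leaving heT htT
    refine ⟨(x, y), mem_deltaPlus.2 ⟨hxy.1, hx, hy⟩, fun hxS => hZ.1.2 ?_⟩
    exact Relation.ReflTransGen.trans (Relation.ReflTransGen.tail hxS hxy) h2
  backward := fun e he T hsT heT => by
    have h1 : Reach ((E : Set (V × V)) \ (Z : Set (V × V))) s e.1 := (mem_deltaPlus.1 he).2.1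
    obtain ⟨x, y, h2, -, hxy, hx, hy⟩ := h1.exists_leaving hsT heT
    exact ⟨(x, y), mem_deltaPlus.2 ⟨hxy.1, hx, hy⟩, Relation.ReflTransGen.tail h2 hxy⟩

lemma isMinCutAug_of_sides {A : Finset (V × V)} (hZ : IsMinimalCut E s t Z)
    (hSA : sSide E s Z ∈ Sides A s t)
    (hmin : ∀ X ∈ Sides A s t, Z.card ≤ (deltaPlus E X).card) : IsMinCutAug E A s t Z := by
  refine ⟨⟨hZ.1.1, fun h => ?_⟩, fun Z' hZ' => ?_⟩
  · obtain ⟨x, y, -, -, hxy, hx, hy⟩ := h.exists_leaving hSA.1 hSA.2.1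
    rcases hxy with hxy | hxy
    · exact hy (Relation.ReflTransGen.tail hx hxy)
    · exact hy (hSA.2.2 x y hxy hx)
  · let X : Set V := {v | Reach (((E : Set (V × V)) \ (Z' : Set (V × V))) ∪ (A : Set (V × V))) s v}
    refine (hmin X ⟨Relation.ReflTransGen.refl, hZ'.2, fun u v huv hu =>
      Relation.ReflTransGen.tail hu (Or.inr huv)⟩).trans (Finset.card_le_card fun e he => ?_)
    obtain ⟨h1, h2, h3⟩ := mem_deltaPlus.1 he
    by_contra h4
    exact h3 (Relation.ReflTransGen.tail h2 (Or.inl ⟨h1, h4⟩))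

end MinimalCuts

section Counting

lemma card_guess (c k : ℕ) : Fintype.card (Guess (Fin c) (2 * k)) =
    3 ^ c * ((2 * k + 2) * ((2 * k + 2) * ((c + 1) * (c + (c + 1))))) := by
  simp [Guess]

lemma card_guess_le {c k : ℕ} (hc : c ≤ k) :
    Fintype.card (Guess (Fin c) (2 * k)) ≤ 2 ^ (6 * (k + 2)) := by
  rw [card_guess]
  have h1 : k + 1 < 2 ^ (k + 1) := Nat.lt_two_pow_self
  have h2 : 3 ^ c ≤ 2 ^ (2 * k) := by
    rw [pow_mul]
    exact (Nat.pow_le_pow_left (by norm_num) c).trans (Nat.pow_le_pow_right (by norm_num) hc)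
  have h3 : 2 * k + 2 ≤ 2 ^ (k + 2) := by rw [pow_succ]; omega
  have h4 : c + 1 ≤ 2 ^ (k + 1) := by omega
  have h5 : c + (c + 1) ≤ 2 ^ (k + 2) := by rw [pow_succ]; omega
  calc _ ≤ 2 ^ (2 * k) * (2 ^ (k + 2) * (2 ^ (k + 2) * (2 ^ (k + 1) * 2 ^ (k + 2)))) := by gcongr
    _ = 2 ^ (2 * k + (k + 2 + (k + 2 + (k + 1 + (k + 2))))) := by simp only [pow_add]
    _ ≤ _ := Nat.pow_le_pow_right (by norm_num) (by omega)

lemma round_bound {c k : ℕ} (hc : c ≤ k) :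
    2 * c + Fintype.card (Guess (Fin c) (2 * k)) ^ (c * c) ≤ 2 ^ (7 * (k + 2) ^ 3) - 1 := by
  have h1 : Fintype.card (Guess (Fin c) (2 * k)) ^ (c * c) ≤ 2 ^ (6 * (k + 2) ^ 3) :=
    calc _ ≤ (2 ^ (6 * (k + 2))) ^ (c * c) := Nat.pow_le_pow_left (card_guess_le hc) _
      _ = 2 ^ (6 * (k + 2) * (c * c)) := by rw [← pow_mul]
      _ ≤ _ := by
        refine Nat.pow_le_pow_right (by norm_num) ?_
        have : c * c ≤ (k + 2) * (k + 2) := Nat.mul_le_mul (by omega) (by omega)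
        nlinarith
  have h2 : k + 2 ≤ (k + 2) ^ 3 := Nat.le_self_pow (by norm_num) _
  have h3 : 2 * c + 1 ≤ 2 ^ ((k + 2) ^ 3) := by
    have : k + 1 < 2 ^ (k + 1) := Nat.lt_two_pow_self
    have h4 : 2 ^ (k + 2) ≤ 2 ^ ((k + 2) ^ 3) := Nat.pow_le_pow_right (by norm_num) h2
    rw [pow_succ] at h4
    omega
  have h5 : 2 ^ (7 * (k + 2) ^ 3) = 2 ^ ((k + 2) ^ 3) * 2 ^ (6 * (k + 2) ^ 3) := by
    rw [← pow_add]
    ring_nf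
  have h6 (n : ℕ) (hn : n ≠ 0) : 2 ≤ 2 ^ n := Nat.le_self_pow hn 2
  have h7 := h6 ((k + 2) ^ 3) (by simp)
  have h8 := h6 (6 * (k + 2) ^ 3) (by simp)
  have h9 := Nat.add_le_mul h7 h8
  rw [h5]
  omega

end Counting

/-- Deterministic flow-augmentation for minimal `st`-cuts (Theorem 2 / `thm:intro-det`). -/
theorem flow_augmentation_deterministic :
    ∃ C : ℝ, 0 < C ∧
      ∀ (V : Type) [Fintype V] [DecidableEq V] (E : Finset (V × V)) (s t : V),
        s ≠ t → ∀ k : ℕ,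
          ∃ 𝒜 : Finset (Finset (V × V)),
            (𝒜.card : ℝ) ≤
                (2 : ℝ) ^ (C * ((k : ℝ) + 2) ^ 4 * Real.log ((k : ℝ) + 2)) *
                  (2 + Real.log (Fintype.card V)) ^ (C * ((k : ℝ) + 2) ^ 3) ∧
            ∀ Z : Finset (V × V), IsMinimalCut E s t Z → Z.card ≤ k →
              ∃ A ∈ 𝒜, IsCutAug E A s t Z ∧ IsMinCutAug E A s t Z := by
  refine ⟨11, by norm_num, fun V _ _ E s t _ k => ?_⟩
  obtain ⟨𝒜, hcard, hA⟩ := exists_augmenting_rounds E s t (fun c hc => round_bound hc) k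
    (Nat.le_succ k)
  refine ⟨𝒜, ?_, fun Z hZ hZk => ?_⟩
  · have h1 : 𝒜.card ≤ 2 ^ (7 * (k + 2) ^ 4) := by
      rw [Nat.sub_add_cancel Nat.one_le_two_pow, ← pow_mul] at hcard
      refine hcard.trans (Nat.pow_le_pow_right (by norm_num) ?_)
      calc 7 * (k + 2) ^ 3 * k ≤ 7 * (k + 2) ^ 3 * (k + 2) := Nat.mul_le_mul_left _ (by omega)
        _ = 7 * (k + 2) ^ 4 := by ring
    have h2 : (7 : ℝ) * ((k : ℝ) + 2) ^ 4 ≤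
        11 * ((k : ℝ) + 2) ^ 4 * Real.log ((k : ℝ) + 2) := by
      have h3 : Real.log 2 ≤ Real.log ((k : ℝ) + 2) :=
        Real.log_le_log (by norm_num) (by linarith [k.cast_nonneg (α := ℝ)])
      have h4 := Real.log_two_gt_d9
      have h5 : (0 : ℝ) ≤ ((k : ℝ) + 2) ^ 4 := by positivity
      nlinarith
    have h3 : (1 : ℝ) ≤ (2 + Real.log (Fintype.card V)) ^ (11 * ((k : ℝ) + 2) ^ 3) :=
      Real.one_le_rpow (by linarith [Real.log_natCast_nonneg (Fintype.card V)])
        (mul_nonneg (by norm_num) (pow_nonneg (by linarith [k.cast_nonneg (α := ℝ)]) 3))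
    calc (𝒜.card : ℝ) ≤ ((2 ^ (7 * (k + 2) ^ 4) : ℕ) : ℝ) := by exact_mod_cast h1
      _ = (2 : ℝ) ^ ((7 : ℝ) * ((k : ℝ) + 2) ^ 4) := by
        rw [show (7 : ℝ) * ((k : ℝ) + 2) ^ 4 = ((7 * (k + 2) ^ 4 : ℕ) : ℝ) by push_cast; rfl,
          Real.rpow_natCast, Nat.cast_pow, Nat.cast_ofNat]
      _ ≤ (2 : ℝ) ^ (11 * ((k : ℝ) + 2) ^ 4 * Real.log ((k : ℝ) + 2)) :=
        Real.rpow_le_rpow_of_exponent_le (by norm_num) h2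
      _ ≤ _ := le_mul_of_one_le_right (by positivity) h3
  · have hd := hZ.deltaPlus_sSide
    obtain ⟨A, hAm, hSA, hmin⟩ := hA (sSide E s Z) hZ.tight (hd.symm ▸ hZk)
    rw [hd, min_eq_right hZk] at hmin
    have := isMinCutAug_of_sides hZ hSA hmin
    exact ⟨A, hAm, this.1, this⟩

end FlowAug
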